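/- arXiv:2005.03783 — 2 statements merged into one kernel-verified Lean document; each statement's English description precedes it below -/
import Mathlib

section
/- (Llibre–MacKay) Let f be a homeomorphism of the torus 𝕋² = ℝ²/ℤ² isotopic to the identity, with lift F : ℝ² → ℝ² satisfying F(x + m) = F(x) + m for all m ∈ ℤ². Suppose there exist three points x₁, x₂, x₃ ∈ ℝ², positive integers q₁, q₂, q₃, and vectors p₁, p₂, p₃ ∈ ℤ² with F^{qᵢ}(xᵢ) = xᵢ + pᵢ for i = 1, 2, 3, such that the rotation vectors v₁ = p₁/q₁, v₂ = p₂/q₂, v₃ = p₃/q₃ are noncollinear (they do not all lie on a single affine line in ℝ²). Then the topological entropy of f is positive. -/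
open Filter Topology

/-- A nowhere vanishing planar map on the plane has a continuous angle function, measured here in
quarter turns. -/
theorem exists_quarterTurn_lift (u v : ℝ × ℝ → ℝ) (hu : Continuous u) (hv : Continuous v)
    (h : ∀ x, u x = 0 → v x ≠ 0) :
    ∃ θ : ℝ × ℝ → ℝ, Continuous θ ∧ ∃ r : ℝ × ℝ → ℝ, (∀ x, 0 < r x) ∧
      (∀ x, u x = r x * Real.cos (Real.pi / 2 * θ x)) ∧
      (∀ x, v x = r x * Real.sin (Real.pi / 2 * θ x)) := by
  let z : C(ℝ × ℝ, ℂ) := ⟨fun x => ⟨u x, v x⟩, by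
    have : (fun x => (⟨u x, v x⟩ : ℂ)) = fun x => (u x : ℂ) + v x * Complex.I := by
      funext x; apply Complex.ext <;> simp
    rw [this]; fun_prop⟩
  have hz : ∀ x, z x ≠ 0 := by
    intro x hx
    have h1 := congrArg Complex.re hx
    have h2 := congrArg Complex.im hx
    exact h x h1 h2
  obtain ⟨w, ⟨-, hw⟩, -⟩ := Complex.isCoveringMapOn_exp.existsUnique_continuousMap_lifts z
    (a₀ := (0 : ℝ × ℝ)) (e₀ := Complex.log (z 0)) (Complex.exp_log (hz 0)) hz
  have hw' : ∀ x, Complex.exp (w x) = z x := fun x => congrFun hw x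
  have hpi := Real.pi_pos
  have e : ∀ x, Real.pi / 2 * ((w x).im / (Real.pi / 2)) = (w x).im := fun x => by field_simp
  refine ⟨fun x => (w x).im / (Real.pi / 2), by fun_prop, fun x => Real.exp (w x).re,
    fun x => Real.exp_pos _, fun x => ?_, fun x => ?_⟩
  · rw [e, ← Complex.exp_re, hw']; rfl
  · rw [e, ← Complex.exp_im, hw']; rfl

theorem exists_int_near_of_cos_pos {t : ℝ} (h : 0 < Real.cos (Real.pi / 2 * t)) :
    ∃ k : ℤ, |t - 4 * k| < 1 := by
  refine ⟨round (t / 4), ?_⟩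
  have h1 := abs_sub_round (t / 4)
  rw [abs_le] at h1
  by_contra hc
  rw [not_lt, le_abs] at hc
  have hpi := Real.pi_pos
  have h2 : Real.cos (Real.pi / 2 * t - (round (t / 4) : ℤ) * (2 * Real.pi)) ≤ 0 := by
    rcases hc with hc | hc
    · apply Real.cos_nonpos_of_pi_div_two_le_of_le <;> nlinarith
    · rw [← Real.cos_neg]
      apply Real.cos_nonpos_of_pi_div_two_le_of_le <;> nlinarith
  rw [Real.cos_sub_int_mul_two_pi] at h2
  linarith

theorem cos_eq_zero_of_odd (k : ℤ) (i : ℤ) (hi : i = 1 ∨ i = -1) :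
    Real.cos (Real.pi / 2 * (4 * k + i)) = 0 := by
  rw [show Real.pi / 2 * (4 * k + i) = Real.pi / 2 * i + k * (2 * Real.pi) by ring,
    Real.cos_add_int_mul_two_pi]
  rcases hi with rfl | rfl <;> simp

/-- Along a connected set on which the angle stays in an open half-plane, the angle stays in one
lift of that half-plane. -/
theorem exists_int_near_of_isPreconnected {α : Type*} [TopologicalSpace α] {A : Set α}
    (hA : IsPreconnected A) {t : α → ℝ} (ht : ContinuousOn t A)
    (h : ∀ x ∈ A, 0 < Real.cos (Real.pi / 2 * t x)) :
    ∃ k : ℤ, ∀ x ∈ A, |t x - 4 * k| < 1 := by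
  rcases A.eq_empty_or_nonempty with rfl | ⟨x₀, hx₀⟩
  · exact ⟨0, by simp⟩
  obtain ⟨k, hk⟩ := exists_int_near_of_cos_pos (h x₀ hx₀)
  refine ⟨k, fun x hx => ?_⟩
  by_contra hc
  rw [abs_lt] at hk
  rw [not_lt, le_abs] at hc
  rcases hc with hc | hc
  · obtain ⟨y, hy, hty⟩ := hA.intermediate_value hx₀ hx ht
      (show (4 * k + (1 : ℤ) : ℝ) ∈ Set.Icc (t x₀) (t x) by
        constructor <;> push_cast <;> linarith)
    have := h y hy
    rw [hty, cos_eq_zero_of_odd k 1 (Or.inl rfl)] at this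
    exact lt_irrefl _ this
  · obtain ⟨y, hy, hty⟩ := hA.intermediate_value hx hx₀ ht
      (show (4 * k + (-1 : ℤ) : ℝ) ∈ Set.Icc (t x) (t x₀) by
        constructor <;> push_cast <;> linarith)
    have := h y hy
    rw [hty, cos_eq_zero_of_odd k (-1) (Or.inr rfl)] at this
    exact lt_irrefl _ this

/-- The lifts of the four open half-planes bounded by the axes, in quarter turns: the half-planes
`0 < u`, `0 < v`, `u < 0`, `v < 0` give angles within `1` of an integer that is `0`, `1`, `2`, `3`
modulo `4`. -/
theorem exists_quarterTurn_lift_sector (u v : ℝ × ℝ → ℝ) (hu : Continuous u) (hv : Continuous v)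
    (h : ∀ x, u x = 0 → v x ≠ 0) :
    ∃ θ : ℝ × ℝ → ℝ, ∀ A : Set (ℝ × ℝ), IsPreconnected A →
      ((∀ x ∈ A, 0 < u x) → ∃ k : ℤ, ∀ x ∈ A, |θ x - (4 * k : ℤ)| < 1) ∧
      ((∀ x ∈ A, 0 < v x) → ∃ k : ℤ, ∀ x ∈ A, |θ x - (4 * k + 1 : ℤ)| < 1) ∧
      ((∀ x ∈ A, u x < 0) → ∃ k : ℤ, ∀ x ∈ A, |θ x - (4 * k + 2 : ℤ)| < 1) ∧
      ((∀ x ∈ A, v x < 0) → ∃ k : ℤ, ∀ x ∈ A, |θ x - (4 * k + 3 : ℤ)| < 1) := by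
  obtain ⟨θ, hθ, r, hr, hur, hvr⟩ := exists_quarterTurn_lift u v hu hv h
  refine ⟨θ, fun A hA => ⟨fun hp => ?_, fun hp => ?_, fun hp => ?_, fun hp => ?_⟩⟩
  · obtain ⟨k, hk⟩ := exists_int_near_of_isPreconnected hA (t := θ) (by fun_prop) fun x hx => by
      have := hp x hx
      rw [hur] at this
      exact pos_of_mul_pos_right this (hr x).le
    exact ⟨k, fun x hx => by simpa using hk x hx⟩
  · obtain ⟨k, hk⟩ := exists_int_near_of_isPreconnected hA (t := fun x => θ x - 1) (by fun_prop)
      fun x hx => by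
        have := hp x hx
        rw [hvr] at this
        have := pos_of_mul_pos_right this (hr x).le
        rwa [mul_sub, mul_one, Real.cos_sub_pi_div_two]
    exact ⟨k, fun x hx => by have := hk x hx; push_cast; rwa [← sub_sub, sub_right_comm]⟩
  · obtain ⟨k, hk⟩ := exists_int_near_of_isPreconnected hA (t := fun x => θ x - 2) (by fun_prop)
      fun x hx => by
        have := hp x hx
        rw [hur] at this
        have : Real.cos (Real.pi / 2 * θ x) < 0 := by
          by_contra hc
          have := mul_nonneg (hr x).le (not_lt.1 hc)
          linarith
        rw [mul_sub, div_mul_cancel₀ _ two_ne_zero, Real.cos_sub_pi]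
        linarith
    exact ⟨k, fun x hx => by have := hk x hx; push_cast; rwa [← sub_sub, sub_right_comm]⟩
  · obtain ⟨k, hk⟩ := exists_int_near_of_isPreconnected hA (t := fun x => θ x - 3) (by fun_prop)
      fun x hx => by
        have := hp x hx
        rw [hvr] at this
        have : Real.sin (Real.pi / 2 * θ x) < 0 := by
          by_contra hc
          have := mul_nonneg (hr x).le (not_lt.1 hc)
          linarith
        rw [show Real.pi / 2 * (θ x - 3) = Real.pi / 2 * θ x + Real.pi / 2 - 2 * Real.pi by ring,
          Real.cos_sub_two_pi, Real.cos_add_pi_div_two]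
        linarith
    exact ⟨k, fun x hx => by have := hk x hx; push_cast; rwa [← sub_sub, sub_right_comm]⟩

theorem int_near_of_near {t : ℝ} {i j : ℤ} (h : |t - i| < 1) (h' : |t - j| < 1) :
    i - j < 2 ∧ j - i < 2 := by
  rw [abs_lt] at h h'
  constructor
  · have : ((i - j : ℤ) : ℝ) < 2 := by push_cast; linarith
    exact_mod_cast this
  · have : ((j - i : ℤ) : ℝ) < 2 := by push_cast; linarith
    exact_mod_cast this

/-- Two paths that cross a rectangle in the two different directions meet. -/
theorem exists_eq_of_crossing (a b : ℝ × ℝ →L[ℝ] ℝ)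
    (hab : ∀ x, a x = 0 → b x = 0 → x = 0) (γ τ : ℝ → ℝ × ℝ) (hγ : Continuous γ)
    (hτ : Continuous τ) (s₀ s₁ t₀ t₁ : ℝ)
    (h0 : ∀ t, a (γ s₀) < a (τ t)) (h1 : ∀ t, a (τ t) < a (γ s₁))
    (h2 : ∀ s, b (τ t₀) < b (γ s)) (h3 : ∀ s, b (γ s) < b (τ t₁)) :
    ∃ s t, γ s = τ t := by
  by_contra! hne
  obtain ⟨θ, hθ⟩ := exists_quarterTurn_lift_sector
    (fun x => a (γ x.1) - a (τ x.2)) (fun x => b (γ x.1) - b (τ x.2))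
    (by fun_prop) (by fun_prop) (fun x hx hx' => hne x.1 x.2 (by
      rw [← sub_eq_zero]; apply hab <;> simpa))
  have hv : ∀ s : ℝ, IsPreconnected ({s} ×ˢ (Set.univ : Set ℝ)) := fun s =>
    isPreconnected_singleton.prod isPreconnected_univ
  have hh : ∀ t : ℝ, IsPreconnected ((Set.univ : Set ℝ) ×ˢ {t}) := fun s =>
    isPreconnected_univ.prod isPreconnected_singleton
  obtain ⟨k0, hk0⟩ := (hθ _ (hv s₀)).2.2.1 (by rintro ⟨s, t⟩ ⟨rfl : s = _, -⟩; simpa using h0 t)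
  obtain ⟨k1, hk1⟩ := (hθ _ (hv s₁)).1 (by rintro ⟨s, t⟩ ⟨rfl : s = _, -⟩; simpa using h1 t)
  obtain ⟨k2, hk2⟩ := (hθ _ (hh t₀)).2.1 (by rintro ⟨s, t⟩ ⟨-, rfl : t = _⟩; simpa using h2 s)
  obtain ⟨k3, hk3⟩ := (hθ _ (hh t₁)).2.2.2 (by rintro ⟨s, t⟩ ⟨-, rfl : t = _⟩; simpa using h3 s)
  have e1 := int_near_of_near (hk0 (s₀, t₀) (by simp)) (hk2 (s₀, t₀) (by simp))
  have e2 := int_near_of_near (hk0 (s₀, t₁) (by simp)) (hk3 (s₀, t₁) (by simp))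
  have e3 := int_near_of_near (hk1 (s₁, t₀) (by simp)) (hk2 (s₁, t₀) (by simp))
  have e4 := int_near_of_near (hk1 (s₁, t₁) (by simp)) (hk3 (s₁, t₁) (by simp))
  omega

/-- Let `r` be a line through `p` along which `X` grows up to an error `D`, and which avoids the
bounded path `γ`. Then `γ` cannot cross the strip of width `2 D` around `p` both below and above
`p`. -/
theorem not_crosses_below_and_above (X Y : ℝ × ℝ →L[ℝ] ℝ)
    (hXY : ∀ x, X x = 0 → Y x = 0 → x = 0) (γ r : ℝ → ℝ × ℝ) (hγ : Continuous γ)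
    (hr : Continuous r) (p : ℝ × ℝ) (D L : ℝ) (hp : r 0 = p)
    (hup : ∀ t, 0 ≤ t → X p - D + t ≤ X (r t)) (hdn : ∀ t, t ≤ 0 → X (r t) ≤ X p + D + t)
    (hL : ∀ s, |X (γ s)| ≤ L) (hne : ∀ s t, γ s ≠ r t)
    (A B : Set ℝ) (hA : IsPreconnected A) (hB : IsPreconnected B)
    (hAY : ∀ s ∈ A, Y (γ s) < Y p) (hBY : ∀ s ∈ B, Y p < Y (γ s))
    {a a' b b' : ℝ} (ha : a ∈ A) (ha' : a' ∈ A) (hb : b ∈ B) (hb' : b' ∈ B)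
    (hXa : X (γ a) < X p - D) (hXa' : X p + D < X (γ a'))
    (hXb : X (γ b) < X p - D) (hXb' : X p + D < X (γ b')) : False := by
  obtain ⟨θ, hθ⟩ := exists_quarterTurn_lift_sector
    (fun x => X (r x.2) - X (γ x.1)) (fun x => Y (r x.2) - Y (γ x.1))
    (by fun_prop) (by fun_prop) (fun x hx hx' => hne x.1 x.2 (by
      symm; rw [← sub_eq_zero]; apply hXY <;> simpa))
  have hv : ∀ (s : ℝ) (T : Set ℝ), IsPreconnected T → IsPreconnected ({s} ×ˢ T) := fun s T hT =>
    isPreconnected_singleton.prod hT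
  have hh : ∀ (t : ℝ) (T : Set ℝ), IsPreconnected T → IsPreconnected (T ×ˢ {t}) := fun s T hT =>
    hT.prod isPreconnected_singleton
  set T := |X p| + |D| + |L| + 1 with hT
  have hX := abs_le.1 (le_refl |X p|)
  have hD := abs_le.1 (le_refl |D|)
  have hL' := abs_le.1 (le_refl |L|)
  have hT0 : 0 ≤ T := by positivity
  obtain ⟨k, hk⟩ := (hθ _ (hh T _ isPreconnected_univ)).1 (by
    rintro ⟨s, t⟩ ⟨-, rfl : t = _⟩
    have := hup T hT0
    have := abs_le.1 (hL s)
    simp only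
    linarith)
  obtain ⟨l, hl⟩ := (hθ _ (hh (-T) _ isPreconnected_univ)).2.2.1 (by
    rintro ⟨s, t⟩ ⟨-, rfl : t = _⟩
    have := hdn (-T) (by linarith)
    have := abs_le.1 (hL s)
    simp only
    linarith)
  obtain ⟨i, hi⟩ := (hθ _ (hh 0 _ hA)).2.1 (by
    rintro ⟨s, t⟩ ⟨hs, rfl : t = _⟩
    have := hAY s hs
    simp only [hp]
    linarith)
  obtain ⟨j, hj⟩ := (hθ _ (hh 0 _ hB)).2.2.2 (by
    rintro ⟨s, t⟩ ⟨hs, rfl : t = _⟩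
    have := hBY s hs
    simp only [hp]
    linarith)
  have left : ∀ s, X (γ s) < X p - D →
      ∃ m : ℤ, ∀ t, 0 ≤ t → |θ (s, t) - (4 * m : ℤ)| < 1 := by
    intro s hs
    obtain ⟨m, hm⟩ := (hθ _ (hv s (Set.Ici 0) isPreconnected_Ici)).1 (by
      rintro ⟨s', t⟩ ⟨rfl : s' = _, ht⟩
      have := hup t ht
      have : (0 : ℝ) ≤ t := ht
      simp only
      linarith)
    exact ⟨m, fun t ht => hm (s, t) (by simpa using ht)⟩
  have right : ∀ s, X p + D < X (γ s) →
      ∃ m : ℤ, ∀ t, t ≤ 0 → |θ (s, t) - (4 * m + 2 : ℤ)| < 1 := by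
    intro s hs
    obtain ⟨m, hm⟩ := (hθ _ (hv s (Set.Iic 0) isPreconnected_Iic)).2.2.1 (by
      rintro ⟨s', t⟩ ⟨rfl : s' = _, ht⟩
      have := hdn t ht
      have : t ≤ (0 : ℝ) := ht
      simp only
      linarith)
    exact ⟨m, fun t ht => hm (s, t) (by simpa using ht)⟩
  obtain ⟨m1, hm1⟩ := left a hXa
  obtain ⟨m2, hm2⟩ := right a' hXa'
  obtain ⟨m3, hm3⟩ := left b hXb
  obtain ⟨m4, hm4⟩ := right b' hXb'
  have e1 := int_near_of_near (hm1 0 le_rfl) (hi (a, 0) (by simpa using ha))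
  have e2 := int_near_of_near (hm1 T hT0) (hk (a, T) (by simp))
  have e3 := int_near_of_near (hm2 0 le_rfl) (hi (a', 0) (by simpa using ha'))
  have e4 := int_near_of_near (hm2 (-T) (by linarith)) (hl (a', -T) (by simp))
  have e5 := int_near_of_near (hm3 0 le_rfl) (hj (b, 0) (by simpa using hb))
  have e6 := int_near_of_near (hm3 T hT0) (hk (b, T) (by simp))
  have e7 := int_near_of_near (hm4 0 le_rfl) (hj (b', 0) (by simpa using hb'))
  have e8 := int_near_of_near (hm4 (-T) (by linarith)) (hl (b', -T) (by simp))
  omega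

/-- The planar path `(x, y)` has no part below height `v` that joins the two sides of the strip
`[u - D, u + D]`. -/
def NoCrossingBelow (x y : ℝ → ℝ) (u v D : ℝ) : Prop :=
  ∀ A : Set ℝ, IsPreconnected A → (∀ s ∈ A, y s < v) →
    ∀ s ∈ A, ∀ s' ∈ A, x s < u - D → u + D < x s' → False

theorem NoCrossingBelow.neg {x y : ℝ → ℝ} {u v D : ℝ} (h : NoCrossingBelow x y u v D) :
    NoCrossingBelow (-x) y (-u) v D := by
  intro A hA hy s hs s' hs' h1 h2
  simp only [Pi.neg_apply] at h1 h2
  exact h A hA hy s' hs' s hs (by linarith) (by linarith)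

theorem forall_lt_of_isPreconnected_trap {f g : ℝ → ℝ} (hf : Continuous f) (hg : Continuous g)
    {α α' β β' : ℝ} (hα : α < α') (hβ : β < β') {s₀ : ℝ} (hf₀ : f s₀ < α') (hg₀ : g s₀ < β')
    (H : ∀ A : Set ℝ, IsPreconnected A → s₀ ∈ A → (∀ s ∈ A, f s < α') → (∀ s ∈ A, g s < β') →
      ∀ s ∈ A, f s ≤ α ∧ g s ≤ β) (s : ℝ) : f s < α' ∧ g s < β' := by
  set U : Set ℝ := {s | f s < α' ∧ g s < β'} with hU
  have hUo : IsOpen U := (isOpen_lt hf continuous_const).inter (isOpen_lt hg continuous_const)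
  have h₀ : s₀ ∈ U := ⟨hf₀, hg₀⟩
  set A := connectedComponentIn U s₀ with hAdef
  have hAU : A ⊆ U := connectedComponentIn_subset U s₀
  have hsA : s₀ ∈ A := mem_connectedComponentIn h₀
  have hA : IsPreconnected A := isPreconnected_connectedComponentIn
  have hle := H A hA hsA (fun s hs => (hAU hs).1) (fun s hs => (hAU hs).2)
  have hcl : closure A ⊆ U := by
    have : closure A ⊆ {s | f s ≤ α ∧ g s ≤ β} :=
      closure_minimal hle ((isClosed_le hf continuous_const).inter
        (isClosed_le hg continuous_const))
    exact fun s hs => ⟨(this hs).1.trans_lt hα, (this hs).2.trans_lt hβ⟩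
  have hclA : closure A ⊆ A :=
    hA.closure.subset_connectedComponentIn (subset_closure hsA) hcl
  have : A = Set.univ := IsClopen.eq_univ
    ⟨isClosed_of_closure_subset hclA, hUo.connectedComponentIn⟩ ⟨s₀, hsA⟩
  exact hAU (this ▸ Set.mem_univ s)

/-- A corner formed by two obstructions confines a path. -/
theorem NoCrossingBelow.trap {x y : ℝ → ℝ} (hx : Continuous x) (hy : Continuous y)
    {p₁ p₂ q₁ q₂ D : ℝ} (hP : NoCrossingBelow x y p₁ p₂ D) (hQ : NoCrossingBelow y x q₂ q₁ D)
    (h₁ : p₁ + D < q₁) (h₂ : q₂ + D < p₂) (hD : 0 ≤ D) {s₀ : ℝ} (hs₁ : x s₀ < p₁ - D)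
    (hs₂ : y s₀ < q₂ - D) (s : ℝ) : x s < q₁ ∧ y s < p₂ := by
  refine forall_lt_of_isPreconnected_trap hx hy h₁ h₂ (s₀ := s₀) (by linarith) (by linarith)
    (fun A hA hs₀ hxA hyA s hs => ⟨?_, ?_⟩) s
  · by_contra hc
    exact hP A hA hyA s₀ hs₀ s hs hs₁ (not_le.1 hc)
  · by_contra hc
    exact hQ A hA hxA s₀ hs₀ s hs hs₂ (not_le.1 hc)

theorem four_quadrants_of_same_side {x y : ℝ → ℝ} (hx : Continuous x) (hy : Continuous y)
    {c₁ c₂ E : ℝ} (hE : 0 < E) {u p₁ p₂ p₁' p₂' q₁ q₂ : ℝ}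
    (hu : |u - c₁| ≤ 4 * E)
    (hp₁ : |p₁ - (u - 7 / 2 * E)| ≤ E) (hp₂ : |p₂ - c₂| ≤ E)
    (hp₁' : u + 5 / 2 * E ≤ p₁' ∧ p₁' ≤ c₁ + 8 * E)
    (hp₂' : |p₂' - c₂| ≤ E) (hq₁ : |q₁ - u| ≤ E) (hq₂ : |q₂ - (c₂ - 4 * E)| ≤ E)
    (hP : NoCrossingBelow x y p₁ p₂ E) (hP' : NoCrossingBelow x y p₁' p₂' E)
    (hQ : NoCrossingBelow y x q₂ q₁ E ∨ NoCrossingBelow y (-x) q₂ (-q₁) E)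
    {s₁ s₂ s₄ : ℝ}
    (h₁ : x s₁ < c₁ - 16 * E ∧ y s₁ < c₂ - 16 * E) (h₂ : c₁ + 16 * E < x s₂ ∧ c₂ + 16 * E < y s₂)
    (h₄ : c₁ + 16 * E < x s₄ ∧ y s₄ < c₂ - 16 * E) : False := by
  rw [abs_le] at *
  rcases hQ with hQ | hQ
  · have := (hP.trap hx hy hQ (by linarith) (by linarith) hE.le (s₀ := s₁) (by linarith)
      (by linarith) s₂).2
    linarith
  · have := (hP'.neg.trap hx.neg hy hQ (by linarith) (by linarith) hE.le (s₀ := s₄)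
      (by simp only [Pi.neg_apply]; linarith) (by linarith) s₂).2
    linarith

/-- If every place near `(c₁, c₂)` is close to obstructions in both directions, then a path cannot
visit all four quadrants around `(c₁, c₂)`. -/
theorem not_meets_four_quadrants {x y : ℝ → ℝ} (hx : Continuous x) (hy : Continuous y)
    {c₁ c₂ E : ℝ} (hE : 0 < E)
    (hP : ∀ u v, |u - c₁| ≤ 8 * E → |v - c₂| ≤ 8 * E → ∃ p₁ p₂, |p₁ - u| ≤ E ∧ |p₂ - v| ≤ E ∧
      (NoCrossingBelow x y p₁ p₂ E ∨ NoCrossingBelow x (-y) p₁ (-p₂) E))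
    (hQ : ∀ u v, |u - c₁| ≤ 8 * E → |v - c₂| ≤ 8 * E → ∃ q₁ q₂, |q₁ - u| ≤ E ∧ |q₂ - v| ≤ E ∧
      (NoCrossingBelow y x q₂ q₁ E ∨ NoCrossingBelow y (-x) q₂ (-q₁) E))
    {s₁ s₂ s₃ s₄ : ℝ}
    (h₁ : x s₁ < c₁ - 16 * E ∧ y s₁ < c₂ - 16 * E) (h₂ : c₁ + 16 * E < x s₂ ∧ c₂ + 16 * E < y s₂)
    (h₃ : x s₃ < c₁ - 16 * E ∧ c₂ + 16 * E < y s₃) (h₄ : c₁ + 16 * E < x s₄ ∧ y s₄ < c₂ - 16 * E) :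
    False := by
  have hE' := abs_of_pos hE
  have habs : ∀ r : ℝ, |r| ≤ 8 → |r * E| ≤ 8 * E := fun r hr => by
    rw [abs_mul, hE']; exact mul_le_mul_of_nonneg_right hr hE.le
  obtain ⟨a₁, a₂, ha₁, ha₂, ha⟩ := hP (c₁ + (-7) * E) c₂ (by
    rw [add_sub_cancel_left]; exact habs _ (by norm_num)) (by simp; linarith)
  obtain ⟨b₁, b₂, hb₁, hb₂, hb⟩ := hP c₁ c₂ (by simp; linarith) (by simp; linarith)
  obtain ⟨d₁, d₂, hd₁, hd₂, hd⟩ := hP (c₁ + 7 * E) c₂ (by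
    rw [add_sub_cancel_left]; exact habs _ (by norm_num)) (by simp; linarith)
  have below : ∀ u p₁ p₂ p₁' p₂' : ℝ, |u - c₁| ≤ 4 * E → |p₁ - (u - 7 / 2 * E)| ≤ E →
      |p₂ - c₂| ≤ E → u + 5 / 2 * E ≤ p₁' ∧ p₁' ≤ c₁ + 8 * E → |p₂' - c₂| ≤ E →
      NoCrossingBelow x y p₁ p₂ E → NoCrossingBelow x y p₁' p₂' E → False := by
    intro u p₁ p₂ p₁' p₂' hu hp₁ hp₂ hp₁' hp₂' hP hP'
    obtain ⟨q₁, q₂, hq₁, hq₂, hq⟩ := hQ u (c₂ - 4 * E) (by linarith) (by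
      rw [sub_sub_cancel_left, abs_neg]; exact habs 4 (by norm_num) |>.trans (by linarith))
    exact four_quadrants_of_same_side hx hy hE hu hp₁ hp₂ hp₁' hp₂' hq₁ hq₂ hP hP' hq h₁ h₂ h₄
  have above : ∀ u p₁ p₂ p₁' p₂' : ℝ, |u - c₁| ≤ 4 * E → |p₁ - (u - 7 / 2 * E)| ≤ E →
      |p₂ - c₂| ≤ E → u + 5 / 2 * E ≤ p₁' ∧ p₁' ≤ c₁ + 8 * E → |p₂' - c₂| ≤ E →
      NoCrossingBelow x (-y) p₁ (-p₂) E → NoCrossingBelow x (-y) p₁' (-p₂') E → False := by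
    intro u p₁ p₂ p₁' p₂' hu hp₁ hp₂ hp₁' hp₂' hP hP'
    obtain ⟨q₁, q₂, hq₁, hq₂, hq⟩ := hQ u (c₂ + 4 * E) (by linarith) (by
      rw [add_sub_cancel_left]; exact habs 4 (by norm_num) |>.trans (by linarith))
    refine four_quadrants_of_same_side hx hy.neg hE (c₂ := -c₂) (q₂ := -q₂) (p₂ := -p₂)
      (p₂' := -p₂') hu hp₁ ?_ hp₁' ?_ hq₁ ?_ hP hP'
      (hq.imp (fun h => h.neg) (fun h => h.neg)) (s₁ := s₃) (s₂ := s₄) (s₄ := s₂)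
      ?_ ?_ ?_
    · rw [abs_sub_comm]; convert hp₂ using 2; ring
    · rw [abs_sub_comm]; convert hp₂' using 2; ring
    · rw [abs_sub_comm]; convert hq₂ using 2; ring
    all_goals
      simp only [Pi.neg_apply]
      constructor <;> linarith
  rw [abs_le] at ha₁ hb₁ hd₁
  have key : ∀ u p₁ p₂ p₁' p₂' : ℝ, |u - c₁| ≤ 4 * E → |p₁ - (u - 7 / 2 * E)| ≤ E →
      |p₂ - c₂| ≤ E → u + 5 / 2 * E ≤ p₁' ∧ p₁' ≤ c₁ + 8 * E → |p₂' - c₂| ≤ E →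
      (NoCrossingBelow x y p₁ p₂ E ∧ NoCrossingBelow x y p₁' p₂' E) ∨
      (NoCrossingBelow x (-y) p₁ (-p₂) E ∧ NoCrossingBelow x (-y) p₁' (-p₂') E) → False := by
    rintro u p₁ p₂ p₁' p₂' h1 h2 h3 h4 h5 (⟨h, h'⟩ | ⟨h, h'⟩)
    · exact below u p₁ p₂ p₁' p₂' h1 h2 h3 h4 h5 h h'
    · exact above u p₁ p₂ p₁' p₂' h1 h2 h3 h4 h5 h h'
  have kab := key (c₁ - 7 / 2 * E) a₁ a₂ b₁ b₂ (by rw [abs_le]; constructor <;> linarith)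
    (by rw [abs_le]; constructor <;> linarith) ha₂ ⟨by linarith, by linarith⟩ hb₂
  have kad := key (c₁ - 7 / 2 * E) a₁ a₂ d₁ d₂ (by rw [abs_le]; constructor <;> linarith)
    (by rw [abs_le]; constructor <;> linarith) ha₂ ⟨by linarith, by linarith⟩ hd₂
  have kbd := key (c₁ + 7 / 2 * E) b₁ b₂ d₁ d₂ (by rw [abs_le]; constructor <;> linarith)
    (by rw [abs_le]; constructor <;> linarith) hb₂ ⟨by linarith, by linarith⟩ hd₂
  tauto

/-- The integer vector `k`, as a point of the plane. -/
def latticePoint (k : ℤ × ℤ) : ℝ × ℝ := ((k.1 : ℝ), (k.2 : ℝ))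

theorem homeomorph_mul_apply (F G : (ℝ × ℝ) ≃ₜ (ℝ × ℝ)) (x : ℝ × ℝ) : (F * G) x = F (G x) := rfl

theorem zpow_add_apply (F : (ℝ × ℝ) ≃ₜ (ℝ × ℝ)) (m n : ℤ) (x : ℝ × ℝ) :
    (F ^ (m + n)) x = (F ^ m) ((F ^ n) x) := by
  rw [zpow_add, homeomorph_mul_apply]

theorem zpow_neg_apply_zpow_apply (F : (ℝ × ℝ) ≃ₜ (ℝ × ℝ)) (n : ℤ) (x : ℝ × ℝ) :
    (F ^ (-n)) ((F ^ n) x) = x := by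
  rw [← zpow_add_apply, neg_add_cancel, zpow_zero]; rfl

theorem zpow_apply_zpow_neg_apply (F : (ℝ × ℝ) ≃ₜ (ℝ × ℝ)) (n : ℤ) (x : ℝ × ℝ) :
    (F ^ n) ((F ^ (-n)) x) = x := by
  rw [← zpow_add_apply, add_neg_cancel, zpow_zero]; rfl

theorem zpow_apply_comm (F : (ℝ × ℝ) ≃ₜ (ℝ × ℝ)) (m n : ℤ) (x : ℝ × ℝ) :
    (F ^ m) ((F ^ n) x) = (F ^ n) ((F ^ m) x) := by
  rw [← zpow_add_apply, add_comm, zpow_add_apply]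

theorem zpow_apply_add_latticePoint {F : (ℝ × ℝ) ≃ₜ (ℝ × ℝ)}
    (hF : ∀ x k, F (x + latticePoint k) = F x + latticePoint k) (n : ℤ) (x : ℝ × ℝ) (k : ℤ × ℤ) :
    (F ^ n) (x + latticePoint k) = (F ^ n) x + latticePoint k := by
  have h : Commute (Homeomorph.addRight (latticePoint k)) F := by
    ext1 x
    exact (hF x k).symm
  exact (DFunLike.congr_fun (h.zpow_right n).eq x).symm

theorem norm_zpow_apply_sub_le {F : (ℝ × ℝ) ≃ₜ (ℝ × ℝ)} {C : ℝ} (hC : ∀ x, ‖F x - x‖ ≤ C)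
    (n : ℤ) (x : ℝ × ℝ) : ‖(F ^ n) x - x‖ ≤ C * |(n : ℝ)| := by
  have hnat : ∀ (n : ℕ) (x : ℝ × ℝ), ‖(F ^ n) x - x‖ ≤ C * n := by
    intro n
    induction n with
    | zero => intro x; simp
    | succ n ih =>
      intro x
      rw [pow_succ', homeomorph_mul_apply]
      calc ‖F ((F ^ n) x) - x‖ ≤ ‖F ((F ^ n) x) - (F ^ n) x‖ + ‖(F ^ n) x - x‖ :=
            norm_sub_le_norm_sub_add_norm_sub _ _ _
        _ ≤ C + C * n := add_le_add (hC _) (ih x)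
        _ = C * (n + 1 : ℕ) := by push_cast; ring
  obtain ⟨m, rfl | rfl⟩ := n.eq_nat_or_neg
  · rw [zpow_natCast, Int.cast_natCast, Nat.abs_cast]
    exact hnat m x
  · have := hnat m ((F ^ (-(m : ℤ))) x)
    rw [← zpow_natCast, zpow_apply_zpow_neg_apply, norm_sub_rev] at this
    rwa [Int.cast_neg, Int.cast_natCast, abs_neg, Nat.abs_cast]

/-- The largest displacement of `F ^ n` in the direction of the functional `ν`. -/
noncomputable def maxDisplacement (F : (ℝ × ℝ) ≃ₜ (ℝ × ℝ)) (ν : ℝ × ℝ →L[ℝ] ℝ) (n : ℕ) : ℝ :=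
  ⨆ x, ν ((F ^ (n : ℤ)) x - x)

section

variable {F : (ℝ × ℝ) ≃ₜ (ℝ × ℝ)} {C : ℝ} (hC : ∀ x, ‖F x - x‖ ≤ C) (ν : ℝ × ℝ →L[ℝ] ℝ)

include hC

theorem le_maxDisplacement (n : ℕ) (x : ℝ × ℝ) :
    ν ((F ^ (n : ℤ)) x - x) ≤ maxDisplacement F ν n := by
  refine le_ciSup (f := fun x => ν ((F ^ (n : ℤ)) x - x)) ⟨‖ν‖ * (C * |((n : ℤ) : ℝ)|), ?_⟩ x
  rintro _ ⟨y, rfl⟩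
  exact (le_abs_self _).trans ((ν.le_opNorm _).trans
    (mul_le_mul_of_nonneg_left (norm_zpow_apply_sub_le hC n y) (norm_nonneg _)))

theorem subadditive_maxDisplacement : Subadditive (maxDisplacement F ν) := by
  intro m n
  refine ciSup_le fun x => ?_
  have h1 := le_maxDisplacement hC ν m ((F ^ (n : ℤ)) x)
  have h2 := le_maxDisplacement hC ν n x
  rw [Nat.cast_add, zpow_add_apply]
  simp only [map_sub] at *
  linarith

theorem eventually_two_mul_maxDisplacement_le {η : ℝ} (hη : 0 < η) :
    ∀ᶠ n : ℕ in atTop,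
      2 * maxDisplacement F ν n - maxDisplacement F ν (2 * n) + 1 ≤ η * n := by
  have hsub := subadditive_maxDisplacement hC ν
  have hbdd : BddBelow (Set.range fun n => maxDisplacement F ν n / n) := by
    refine ⟨-(‖ν‖ * C), ?_⟩
    rintro _ ⟨n, rfl⟩
    have hC0 : 0 ≤ C := (norm_nonneg _).trans (hC 0)
    rcases n.eq_zero_or_pos with rfl | hn
    · simp; positivity
    · have hn' : (0 : ℝ) < n := by exact_mod_cast hn
      simp only
      rw [le_div_iff₀ hn']
      have h1 := le_maxDisplacement hC ν n 0
      have h2 := (abs_le.1 ((ν.le_opNorm _).trans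
        (mul_le_mul_of_nonneg_left (norm_zpow_apply_sub_le hC n 0) (norm_nonneg ν)))).1
      simp only [Int.cast_natCast, Nat.abs_cast] at h2
      nlinarith
  have hlim := hsub.tendsto_lim hbdd
  have h1 : ∀ᶠ n : ℕ in atTop, maxDisplacement F ν n / n < hsub.lim + η / 4 :=
    hlim.eventually_lt_const (by linarith)
  have h2 : ∀ᶠ n : ℕ in atTop, 2 / η ≤ n :=
    tendsto_natCast_atTop_atTop.eventually_ge_atTop _
  filter_upwards [h1, h2, eventually_gt_atTop 0] with n h1 h2 hn
  have hn' : (0 : ℝ) < n := by exact_mod_cast hn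
  have h3 := hsub.lim_le_div hbdd (n := 2 * n) (by omega)
  rw [le_div_iff₀ (by positivity)] at h3
  rw [div_lt_iff₀ hn'] at h1
  rw [div_le_iff₀ hη] at h2
  push_cast at h3
  nlinarith

theorem exists_long_line (hν : ν ≠ 0) {J : ℕ} {D : ℝ}
    (hD : 2 * maxDisplacement F ν J - maxDisplacement F ν (2 * J) + 1 ≤ D) :
    ∃ (p : ℝ × ℝ) (r : ℝ → ℝ × ℝ), Continuous r ∧ r 0 = p ∧
      (∀ t, 0 ≤ t → ν p - D + t ≤ ν (r t) ∧
        ν p + maxDisplacement F ν J - D ≤ ν ((F ^ (J : ℤ)) (r t))) ∧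
      (∀ t, t ≤ 0 → ν (r t) ≤ ν p + D + t ∧
        ν ((F ^ (-(J : ℤ))) (r t)) ≤ ν p - maxDisplacement F ν J + D) := by
  obtain ⟨z, hz⟩ := exists_lt_of_lt_ciSup
    (show maxDisplacement F ν (2 * J) - 1 < ⨆ x, ν ((F ^ ((2 * J : ℕ) : ℤ)) x - x) by
      change _ < maxDisplacement F ν (2 * J); linarith)
  obtain ⟨v, hv⟩ : ∃ v, ν v ≠ 0 := by
    by_contra! h
    exact hν (ContinuousLinearMap.ext h)
  set ξ := (ν v)⁻¹ • v with hξ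
  have hνξ : ν ξ = 1 := by simp [hξ, hv]
  set p := (F ^ (J : ℤ)) z with hp
  have h2J : (F ^ ((2 * J : ℕ) : ℤ)) z = (F ^ (J : ℤ)) p := by
    rw [hp, ← zpow_add_apply]; congr 2; push_cast; ring
  rw [h2J] at hz
  have hmp : (F ^ (-(J : ℤ))) p = z := zpow_neg_apply_zpow_apply F _ z
  have hpz := le_maxDisplacement hC ν J z
  have hpp := le_maxDisplacement hC ν J p
  rw [← hp] at hpz
  set up : ℝ → ℝ × ℝ := fun t => (F ^ (-(J : ℤ))) ((F ^ (J : ℤ)) p + t • ξ) with hup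
  set dn : ℝ → ℝ × ℝ := fun t => (F ^ (J : ℤ)) ((F ^ (-(J : ℤ))) p + t • ξ) with hdn
  have cup : Continuous up := (F ^ (-(J : ℤ))).continuous.comp (by fun_prop)
  have cdn : Continuous dn := (F ^ (J : ℤ)).continuous.comp (by fun_prop)
  have hFup : ∀ t, (F ^ (J : ℤ)) (up t) = (F ^ (J : ℤ)) p + t • ξ := fun t => by
    simp only [hup, zpow_apply_zpow_neg_apply]
  have hFdn : ∀ t, (F ^ (-(J : ℤ))) (dn t) = z + t • ξ := fun t => by
    simp only [hdn, hmp, zpow_neg_apply_zpow_apply]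
  refine ⟨p, fun t => if t ≤ 0 then dn t else up t, ?_, ?_, fun t ht => ?_, fun t ht => ?_⟩
  · refine cdn.if_le cup continuous_id continuous_const fun t ht => ?_
    obtain rfl : t = 0 := ht
    simp only [hup, hdn, zero_smul, add_zero, zpow_neg_apply_zpow_apply,
      zpow_apply_zpow_neg_apply]
  · simp only [le_refl, if_true, hdn, zero_smul, add_zero, zpow_apply_zpow_neg_apply]
  · have key : ν p - D + t ≤ ν (up t) ∧
        ν p + maxDisplacement F ν J - D ≤ ν ((F ^ (J : ℤ)) (up t)) := by
      have h3 := le_maxDisplacement hC ν J (up t)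
      rw [hFup] at h3 ⊢
      simp only [map_sub, map_add, map_smul, smul_eq_mul, hνξ, mul_one] at *
      constructor <;> linarith
    rcases ht.eq_or_lt with rfl | ht
    · have h0 : up 0 = dn 0 := by
        simp only [hup, hdn, zero_smul, add_zero, zpow_neg_apply_zpow_apply,
          zpow_apply_zpow_neg_apply]
      simp only [le_refl, if_true, ← h0]
      exact key
    · simpa [not_le.2 ht] using key
  · simp only [if_pos ht]
    rw [hFdn]
    have h3 := le_maxDisplacement hC ν J (z + t • ξ)
    rw [hmp.symm] at h3
    change ν (dn t - _) ≤ _ at h3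
    rw [hmp] at h3
    simp only [map_sub, map_add, map_smul, smul_eq_mul, hνξ, mul_one] at *
    constructor <;> linarith

end

/-- The path `ρ` moves slower than `F ^ J` can, by a margin `L`, in the direction of `ν`: near the
level `x₀` of `ν` it cannot meet lines of fastest displacement. -/
def IsSlow (F : (ℝ × ℝ) ≃ₜ (ℝ × ℝ)) (J : ℕ) (ν : ℝ × ℝ →L[ℝ] ℝ) (ρ : ℝ → ℝ × ℝ) (x₀ L : ℝ) :
    Prop :=
  (∀ s, ν ((F ^ (J : ℤ)) (ρ s)) + L < x₀ + maxDisplacement F ν J) ∧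
    ∀ s, x₀ + L < ν ((F ^ (-(J : ℤ))) (ρ s)) + maxDisplacement F ν J

theorem exists_latticePoint_near (x : ℝ × ℝ) : ∃ k, ‖latticePoint k - x‖ ≤ 1 := by
  refine ⟨(round x.1, round x.2), ?_⟩
  rw [Prod.norm_def]
  refine max_le ?_ ?_
  · rw [Real.norm_eq_abs, Prod.fst_sub, abs_sub_comm]
    exact (abs_sub_round x.1).trans (by norm_num)
  · rw [Real.norm_eq_abs, Prod.snd_sub, abs_sub_comm]
    exact (abs_sub_round x.2).trans (by norm_num)

section

variable {F : (ℝ × ℝ) ≃ₜ (ℝ × ℝ)} {C : ℝ}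
  (hF : ∀ x k, F (x + latticePoint k) = F x + latticePoint k) (hC : ∀ x, ‖F x - x‖ ≤ C)

include hF hC

theorem IsSlow.exists_line_disjoint {J : ℕ} {ν : ℝ × ℝ →L[ℝ] ℝ} (hν : ν ≠ 0) {ρ : ℝ → ℝ × ℝ}
    {x₀ L E : ℝ} (hs : IsSlow F J ν ρ x₀ L)
    (hE : 2 * maxDisplacement F ν J - maxDisplacement F ν (2 * J) + 1 ≤ E) :
    ∃ (p : ℝ × ℝ) (r : ℝ → ℝ × ℝ), Continuous r ∧ r 0 = p ∧
      (∀ t, 0 ≤ t → ν p - E + t ≤ ν (r t)) ∧ (∀ t, t ≤ 0 → ν (r t) ≤ ν p + E + t) ∧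
      ∀ k, |ν (p + latticePoint k) - x₀| ≤ L - E → ∀ s t, ρ s ≠ r t + latticePoint k := by
  obtain ⟨p, r, hr, h0, hup, hdn⟩ := exists_long_line hC ν hν hE
  refine ⟨p, r, hr, h0, fun t ht => (hup t ht).1, fun t ht => (hdn t ht).1, ?_⟩
  intro k hk s t hst
  rw [abs_le, map_add] at hk
  rcases le_total 0 t with ht | ht
  · have h1 := hs.1 s
    rw [hst, zpow_apply_add_latticePoint hF, map_add] at h1
    have h2 := (hup t ht).2
    linarith
  · have h1 := hs.2 s
    rw [hst, zpow_apply_add_latticePoint hF, map_add] at h1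
    have h2 := (hdn t ht).2
    linarith

theorem exists_line_disjoint_of_isSlow_or {J : ℕ} {ν : ℝ × ℝ →L[ℝ] ℝ} (hν : ν ≠ 0)
    {ρ : ℝ → ℝ × ℝ} {x₀ L E : ℝ} (hs : IsSlow F J ν ρ x₀ L ∨ IsSlow F J (-ν) ρ (-x₀) L)
    (hE : 2 * maxDisplacement F ν J - maxDisplacement F ν (2 * J) + 1 ≤ E)
    (hE' : 2 * maxDisplacement F (-ν) J - maxDisplacement F (-ν) (2 * J) + 1 ≤ E) :
    ∃ (p : ℝ × ℝ) (r : ℝ → ℝ × ℝ), Continuous r ∧ r 0 = p ∧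
      (∀ t, 0 ≤ t → ν p - E + t ≤ ν (r t)) ∧ (∀ t, t ≤ 0 → ν (r t) ≤ ν p + E + t) ∧
      ∀ k, |ν (p + latticePoint k) - x₀| ≤ L - E → ∀ s t, ρ s ≠ r t + latticePoint k := by
  rcases hs with hs | hs
  · exact hs.exists_line_disjoint hF hC hν hE
  · obtain ⟨p, r, hr, h0, hup, hdn, hk⟩ := hs.exists_line_disjoint hF hC (neg_ne_zero.2 hν) hE'
    refine ⟨p, fun t => r (-t), by fun_prop, by simpa using h0, fun t ht => ?_, fun t ht => ?_,
      fun k h s t => hk k ?_ s (-t)⟩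
    · have := hdn (-t) (by linarith)
      simp only [neg_apply] at this
      linarith
    · have := hup (-t) (by linarith)
      simp only [neg_apply] at this
      linarith
    · rw [neg_apply, neg_sub_neg, abs_sub_comm]; exact h

theorem exists_noCrossing_near {J : ℕ} {X Y : ℝ × ℝ →L[ℝ] ℝ}
    (hXY : ∀ x, X x = 0 → Y x = 0 → x = 0) (hsurj : ∀ u v, ∃ x, X x = u ∧ Y x = v)
    {ρ : ℝ → ℝ × ℝ} (hρ : Continuous ρ) {B : ℝ} (hB : ∀ s, |X (ρ s)| ≤ B) {x₀ E : ℝ}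
    (hs : IsSlow F J X ρ x₀ (10 * E) ∨ IsSlow F J (-X) ρ (-x₀) (10 * E))
    (hE : 2 * maxDisplacement F X J - maxDisplacement F X (2 * J) + 1 ≤ E)
    (hE' : 2 * maxDisplacement F (-X) J - maxDisplacement F (-X) (2 * J) + 1 ≤ E)
    (hXE : ‖X‖ ≤ E) (hYE : ‖Y‖ ≤ E) (u v : ℝ) (hu : |u - x₀| ≤ 8 * E) :
    ∃ p₁ p₂, |p₁ - u| ≤ E ∧ |p₂ - v| ≤ E ∧
      (NoCrossingBelow (X ∘ ρ) (Y ∘ ρ) p₁ p₂ E ∨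
        NoCrossingBelow (X ∘ ρ) (-(Y ∘ ρ)) p₁ (-p₂) E) := by
  have hX0 : X ≠ 0 := by
    rintro rfl
    obtain ⟨x, hx, -⟩ := hsurj 1 0
    simp at hx
  obtain ⟨p, r, hr, h0, hup, hdn, hk⟩ := exists_line_disjoint_of_isSlow_or hF hC hX0 hs hE hE'
  obtain ⟨q, rfl, rfl⟩ := hsurj u v
  obtain ⟨k, hkq⟩ := exists_latticePoint_near (q - p)
  have hbd : ∀ ν : ℝ × ℝ →L[ℝ] ℝ, ‖ν‖ ≤ E → |ν (p + latticePoint k) - ν q| ≤ E := fun ν hν => by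
    rw [← map_sub]
    calc |ν (p + latticePoint k - q)| ≤ ‖ν‖ * ‖p + latticePoint k - q‖ := ν.le_opNorm _
      _ ≤ E * 1 := by
        rw [show p + latticePoint k - q = latticePoint k - (q - p) by abel]
        exact mul_le_mul hν hkq (norm_nonneg _) ((norm_nonneg _).trans hν)
      _ = E := mul_one E
  refine ⟨X (p + latticePoint k), Y (p + latticePoint k), hbd X hXE, hbd Y hYE, ?_⟩
  have hne := hk k (by
    have h1 := hbd X hXE
    rw [abs_le] at *
    constructor <;> linarith)
  by_contra! hcon
  obtain ⟨h1, h2⟩ := hcon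
  simp only [NoCrossingBelow, not_forall] at h1 h2
  obtain ⟨A, hA, hAY, a, ha, a', ha', hXa, hXa', -⟩ := h1
  obtain ⟨A', hA', hAY', b, hb, b', hb', hXb, hXb', -⟩ := h2
  refine not_crosses_below_and_above X Y hXY ρ (fun t => r t + latticePoint k) hρ (by fun_prop)
    (p + latticePoint k) E B (by simp [h0]) (fun t ht => ?_) (fun t ht => ?_) hB hne A A' hA hA'
    hAY (fun s hs => ?_) ha ha' hb hb' hXa hXa' hXb hXb'
  · have := hup t ht
    simp only [map_add]; linarith
  · have := hdn t ht
    simp only [map_add]; linarith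
  · have := hAY' s hs
    simp only [Pi.neg_apply, Function.comp_apply] at this
    linarith

theorem not_meets_four_quadrants_of_isSlow {J : ℕ} {X Y : ℝ × ℝ →L[ℝ] ℝ}
    (hXY : ∀ x, X x = 0 → Y x = 0 → x = 0) (hsurj : ∀ u v, ∃ x, X x = u ∧ Y x = v)
    {ρ : ℝ → ℝ × ℝ} (hρ : Continuous ρ) {B : ℝ} (hBX : ∀ s, |X (ρ s)| ≤ B)
    (hBY : ∀ s, |Y (ρ s)| ≤ B) {c₁ c₂ E : ℝ} (hE : 0 < E)
    (hs₁ : IsSlow F J X ρ c₁ (10 * E) ∨ IsSlow F J (-X) ρ (-c₁) (10 * E))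
    (hs₂ : IsSlow F J Y ρ c₂ (10 * E) ∨ IsSlow F J (-Y) ρ (-c₂) (10 * E))
    (hD : ∀ ν ∈ ({X, -X, Y, -Y} : Set (ℝ × ℝ →L[ℝ] ℝ)),
      2 * maxDisplacement F ν J - maxDisplacement F ν (2 * J) + 1 ≤ E)
    (hXE : ‖X‖ ≤ E) (hYE : ‖Y‖ ≤ E) {s₁ s₂ s₃ s₄ : ℝ}
    (h₁ : X (ρ s₁) < c₁ - 16 * E ∧ Y (ρ s₁) < c₂ - 16 * E)
    (h₂ : c₁ + 16 * E < X (ρ s₂) ∧ c₂ + 16 * E < Y (ρ s₂))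
    (h₃ : X (ρ s₃) < c₁ - 16 * E ∧ c₂ + 16 * E < Y (ρ s₃))
    (h₄ : c₁ + 16 * E < X (ρ s₄) ∧ Y (ρ s₄) < c₂ - 16 * E) : False := by
  refine not_meets_four_quadrants (x := X ∘ ρ) (y := Y ∘ ρ) (by fun_prop) (by fun_prop) hE
    (fun u v hu hv => ?_) (fun u v hu hv => ?_) h₁ h₂ h₃ h₄
  · exact exists_noCrossing_near hF hC hXY hsurj hρ hBX hs₁ (hD _ (by simp)) (hD _ (by simp))
      hXE hYE u v hu
  · obtain ⟨q₁, q₂, h1, h2, h3⟩ := exists_noCrossing_near hF hC (fun x hx hy => hXY x hy hx)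
      (fun u v => (hsurj v u).imp fun x hx => hx.symm) hρ hBY hs₂ (hD _ (by simp))
      (hD _ (by simp)) hYE hXE v u hv
    exact ⟨q₂, q₁, h2, h1, h3⟩

omit hF in
theorem abs_map_zpow_apply_sub_le {ν : ℝ × ℝ →L[ℝ] ℝ} {M : ℝ} (hν : ‖ν‖ ≤ M) {n N : ℕ}
    (hn : n ≤ N) (x : ℝ × ℝ) : |ν ((F ^ (n : ℤ)) x) - ν x| ≤ M * C * N := by
  rw [← map_sub]
  have hC0 : 0 ≤ C := (norm_nonneg _).trans (hC 0)
  have hn' : (n : ℝ) ≤ N := by exact_mod_cast hn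
  calc |ν ((F ^ (n : ℤ)) x - x)| ≤ ‖ν‖ * ‖(F ^ (n : ℤ)) x - x‖ := ν.le_opNorm _
    _ ≤ M * (C * N) := by
      refine mul_le_mul hν ((norm_zpow_apply_sub_le hC n x).trans ?_) (norm_nonneg _)
        ((norm_nonneg _).trans hν)
      simp only [Int.cast_natCast, Nat.abs_cast]
      exact mul_le_mul_of_nonneg_left hn' hC0
    _ = M * C * N := (mul_assoc _ _ _).symm

omit hF in
/-- If `ν` displaces the base point of a short path by less than the maximum, then all iterates
`F ^ n` of the path, `n ≤ N`, are slow. -/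
theorem isSlow_zpow_comp {ν : ℝ × ℝ →L[ℝ] ℝ} {M S E : ℝ} (hν : ‖ν‖ ≤ M) {γ : ℝ → ℝ × ℝ} {J N : ℕ}
    (hJ : ∀ s t, ‖(F ^ (J : ℤ)) (γ s) - (F ^ (J : ℤ)) (γ t)‖ ≤ S)
    (hJ' : ∀ s t, ‖(F ^ (-(J : ℤ))) (γ s) - (F ^ (-(J : ℤ))) (γ t)‖ ≤ S) {s₀ : ℝ}
    (h₁ : ν ((F ^ (J : ℤ)) (γ s₀) - γ s₀) + J / 4 ≤ maxDisplacement F ν J)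
    (h₂ : ν (γ s₀ - (F ^ (-(J : ℤ))) (γ s₀)) + J / 4 ≤ maxDisplacement F ν J)
    (hslack : 3 * M * S + M * C * N + 10 * E < J / 4) {n : ℕ} (hn : n ≤ N) {x₀ : ℝ}
    (hx₀ : |x₀ - ν (γ s₀)| ≤ 2 * M * S) :
    IsSlow F J ν (fun s => (F ^ (n : ℤ)) (γ s)) x₀ (10 * E) := by
  have hS : ∀ x y : ℝ × ℝ, ‖x - y‖ ≤ S → |ν x - ν y| ≤ M * S := fun x y hxy => by
    rw [← map_sub]
    exact (ν.le_opNorm _).trans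
      (mul_le_mul hν hxy (norm_nonneg _) ((norm_nonneg _).trans hν))
  rw [map_sub] at h₁ h₂
  rw [abs_le] at hx₀
  constructor
  · intro s
    rw [zpow_apply_comm]
    have e1 := abs_le.1 (abs_map_zpow_apply_sub_le hC hν hn ((F ^ (J : ℤ)) (γ s)))
    have e2 := abs_le.1 (hS _ _ (hJ s s₀))
    linarith
  · intro s
    rw [zpow_apply_comm]
    have e1 := abs_le.1 (abs_map_zpow_apply_sub_le hC hν hn ((F ^ (-(J : ℤ))) (γ s)))
    have e2 := abs_le.1 (hS _ _ (hJ' s s₀))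
    linarith

end

/-- The iterates `F ^ n`, `n ≤ N`, of the path `γ` are graphs over the middle part of the range of
`a`, up to an error of order `E` in the direction of `b`. -/
def IsRoughGraph (F : (ℝ × ℝ) ≃ₜ (ℝ × ℝ)) (a b : ℝ × ℝ →L[ℝ] ℝ) (γ : ℝ → ℝ × ℝ) (N : ℕ)
    (m W E : ℝ) : Prop :=
  ∀ n : ℕ, n ≤ N → ∀ a₀, |a₀ - m| ≤ W / 8 → ∀ s t, |a ((F ^ (n : ℤ)) (γ s)) - a₀| ≤ E →
    |a ((F ^ (n : ℤ)) (γ t)) - a₀| ≤ E →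
      b ((F ^ (n : ℤ)) (γ s)) - b ((F ^ (n : ℤ)) (γ t)) ≤ 34 * E

section

variable {F : (ℝ × ℝ) ≃ₜ (ℝ × ℝ)} {C : ℝ}
  (hF : ∀ x k, F (x + latticePoint k) = F x + latticePoint k) (hC : ∀ x, ‖F x - x‖ ≤ C)
  {a b : ℝ × ℝ →L[ℝ] ℝ} (hab : ∀ x, a x = 0 → b x = 0 → x = 0)
  (hsurj : ∀ u v, ∃ x, a x = u ∧ b x = v) {γ : ℝ → ℝ × ℝ} (hγ : Continuous γ) {M E W m : ℝ} {N : ℕ}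
  (hMa : ‖a‖ ≤ M) (hMb : ‖b‖ ≤ M) (hE : 0 < E) (hME : M ≤ E) (hN : M * C * N ≤ W / 64)
  (hEW : 64 * E ≤ W) {s₀ s₁ : ℝ} (hs₀ : a (γ s₀) = m - W / 2) (hs₁ : a (γ s₁) = m + W / 2)

theorem natCast_mul_abs_map_le (hC : ∀ x, ‖F x - x‖ ≤ C) {ν : ℝ × ℝ →L[ℝ] ℝ} (hν : ‖ν‖ ≤ M)
    {x : ℝ × ℝ} {w : ℤ × ℤ} (hx : F x = x + latticePoint w) {n : ℕ} (hn : n ≤ N) :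
    |n * ν (latticePoint w)| ≤ M * C * N := by
  have h := hC x
  rw [hx, add_sub_cancel_left] at h
  rw [abs_mul, Nat.abs_cast]
  have h2 : |ν (latticePoint w)| ≤ M * C :=
    (ν.le_opNorm _).trans (mul_le_mul hν h (norm_nonneg _) ((norm_nonneg _).trans hν))
  have hn' : (n : ℝ) ≤ N := by exact_mod_cast hn
  calc (n : ℝ) * |ν (latticePoint w)| ≤ N * (M * C) :=
        mul_le_mul hn' h2 (abs_nonneg _) (Nat.cast_nonneg _)
    _ = M * C * N := mul_comm _ _

theorem natPow_apply_of_translated (hF : ∀ x k, F (x + latticePoint k) = F x + latticePoint k)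
    {x : ℝ × ℝ} {w : ℤ × ℤ} (hx : F x = x + latticePoint w) (k : ℤ × ℤ) (n : ℕ) :
    (F ^ (n : ℤ)) (x + latticePoint k) = x + latticePoint k + (n : ℝ) • latticePoint w := by
  induction n with
  | zero => simp
  | succ n ih =>
    have h : F (x + latticePoint k + (n : ℝ) • latticePoint w) =
        F x + latticePoint k + (n : ℝ) • latticePoint w := by
      have : (n : ℝ) • latticePoint w = latticePoint (n • w) := by
        simp [latticePoint]
      rw [this, hF, hF]
    rw [Nat.cast_succ, add_comm, zpow_add_apply, zpow_one, ih, h, hx, Nat.cast_succ, add_smul,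
      one_smul]
    abel

include hF hC hab hsurj hγ hMa hMb hE hME hN hEW hs₀ hs₁

theorem IsRoughGraph.le_of_translated (hG : IsRoughGraph F a b γ N m W E) {B : ℝ}
    (hB : ∀ s, |b (γ s)| ≤ B) {x : ℝ × ℝ} {w : ℤ × ℤ} (hx : F x = x + latticePoint w) {n : ℕ}
    (hn : n ≤ N) {a₀ : ℝ} (ha₀ : |a₀ - m| ≤ W / 16) {s t : ℝ} (hs : a (γ s) = a₀)
    (ht : a ((F ^ (n : ℤ)) (γ t)) = a₀ + n * a (latticePoint w)) :
    b ((F ^ (n : ℤ)) (γ t)) - b (γ s) - n * b (latticePoint w) ≤ 80 * E := by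
  by_contra! hcon
  have hM0 : 0 ≤ M := (norm_nonneg _).trans hMa
  have hE0 : 0 ≤ E := hE.le
  obtain ⟨e, hae, hbe⟩ := hsurj 0 1
  obtain ⟨q, haq, hbq⟩ := hsurj a₀ (b (γ s) + 40 * E)
  obtain ⟨k, hk⟩ := exists_latticePoint_near (q - x)
  have hnear : ∀ ν : ℝ × ℝ →L[ℝ] ℝ, ‖ν‖ ≤ M → |ν (x + latticePoint k) - ν q| ≤ E := fun ν hν => by
    rw [← map_sub, show x + latticePoint k - q = latticePoint k - (q - x) by abel]
    exact (ν.le_opNorm _).trans ((mul_le_mul hν hk (norm_nonneg _) hM0).trans (by linarith))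
  set p := x + latticePoint k with hp
  have hap := hnear a hMa
  have hbp := hnear b hMb
  rw [haq] at hap
  rw [hbq] at hbp
  have hFp : (F ^ (n : ℤ)) p = p + (n : ℝ) • latticePoint w := natPow_apply_of_translated hF hx k n
  have haw := abs_le.1 (natCast_mul_abs_map_le hC hMa hx hn)
  set τ : ℝ → ℝ × ℝ := fun t =>
    if t ≤ 0 then (F ^ (-(n : ℤ))) ((F ^ (n : ℤ)) p + t • e) else p + t • e with hτ
  have hτc : Continuous τ := by
    refine ((F ^ (-(n : ℤ))).continuous.comp (by fun_prop)).if_le (by fun_prop) continuous_id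
      continuous_const fun t ht => ?_
    obtain rfl : t = 0 := ht
    simp only [Function.comp_apply, zero_smul, add_zero, zpow_neg_apply_zpow_apply]
  have hτn : ∀ t ≤ 0, (F ^ (n : ℤ)) (τ t) = p + (n : ℝ) • latticePoint w + t • e := fun t ht => by
    simp only [hτ, if_pos ht, zpow_apply_zpow_neg_apply, hFp]
  have hτp : ∀ t, 0 < t → τ t = p + t • e := fun t ht => by
    simp only [hτ, if_neg (not_le.2 ht)]
  have hdispl : ∀ ν : ℝ × ℝ →L[ℝ] ℝ, ‖ν‖ ≤ M → ∀ y, |ν ((F ^ (n : ℤ)) y) - ν y| ≤ M * C * N :=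
    fun ν hν y => abs_map_zpow_apply_sub_le hC hν hn y
  have haτ : ∀ t, |a (τ t) - a p| ≤ 2 * (M * C * N) := by
    intro t
    rcases le_or_gt t 0 with ht | ht
    · have h1 := abs_le.1 (hdispl a hMa (τ t))
      rw [hτn t ht] at h1
      simp only [map_add, map_smul, smul_eq_mul, hae] at h1
      rw [abs_le]
      constructor <;> linarith
    · rw [hτp t ht]
      simp only [map_add, map_smul, smul_eq_mul, hae, mul_zero, add_zero, sub_self, abs_zero]
      linarith [abs_nonneg ((n : ℝ) * a (latticePoint w))]
  rw [abs_le] at hap hbp ha₀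
  set t₀ := -(|b p + n * b (latticePoint w)| + |M * C * N| + B + 1) with ht₀
  set t₁ := |b p| + B + 1 with ht₁
  have hB0 : 0 ≤ B := (abs_nonneg _).trans (hB 0)
  have ht₀' : t₀ ≤ 0 := by
    rw [ht₀]
    linarith [abs_nonneg (b p + n * b (latticePoint w)), abs_nonneg (M * C * N)]
  have ht₁' : 0 < t₁ := by positivity
  obtain ⟨s', t', hst⟩ := exists_eq_of_crossing a b hab γ τ hγ hτc s₀ s₁ t₀ t₁
    (fun t => by have := abs_le.1 (haτ t); linarith)
    (fun t => by have := abs_le.1 (haτ t); linarith)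
    (fun s => by
      have h1 := abs_le.1 (hdispl b hMb (τ t₀))
      rw [hτn t₀ ht₀'] at h1
      simp only [map_add, map_smul, smul_eq_mul, hbe] at h1
      have h2 := abs_le.1 (hB s)
      have h3 := le_abs_self (b p + n * b (latticePoint w))
      have h4 := le_abs_self (M * C * N)
      linarith)
    (fun s => by
      rw [hτp t₁ ht₁']
      simp only [map_add, map_smul, smul_eq_mul, hbe]
      have h2 := abs_le.1 (hB s)
      have h3 := neg_abs_le (b p)
      linarith)
  rcases le_or_gt t' 0 with h | h
  · have h1 := hτn t' h
    rw [← hst] at h1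
    have h2 := hG n hn (a₀ + n * a (latticePoint w)) (by rw [abs_le]; constructor <;> linarith)
      t s' (by rw [ht]; simpa using hE0) (by
        rw [h1, abs_le]
        simp only [map_add, map_smul, smul_eq_mul, hae]
        constructor <;> linarith)
    rw [h1] at h2
    simp only [map_add, map_smul, smul_eq_mul, hbe] at h2
    linarith
  · have h1 := hτp t' h
    rw [← hst] at h1
    have h2 := hG 0 (Nat.zero_le _) a₀ (by rw [abs_le]; constructor <;> linarith)
      s' s (by
        rw [Nat.cast_zero, zpow_zero]
        change |a (γ s') - a₀| ≤ E
        rw [h1, abs_le]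
        simp only [map_add, map_smul, smul_eq_mul, hae]
        constructor <;> linarith) (by
          rw [Nat.cast_zero, zpow_zero]
          change |a (γ s) - a₀| ≤ E
          rw [hs]; simpa using hE0)
    rw [Nat.cast_zero, zpow_zero] at h2
    change b (γ s') - b (γ s) ≤ _ at h2
    rw [h1] at h2
    simp only [map_add, map_smul, smul_eq_mul, hbe] at h2
    linarith

theorem IsRoughGraph.abs_le_of_translated (hG : IsRoughGraph F a b γ N m W E) {B : ℝ}
    (hB : ∀ s, |b (γ s)| ≤ B) {x : ℝ × ℝ} {w : ℤ × ℤ} (hx : F x = x + latticePoint w) {n : ℕ}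
    (hn : n ≤ N) {a₀ : ℝ} (ha₀ : |a₀ - m| ≤ W / 16) {s t : ℝ} (hs : a (γ s) = a₀)
    (ht : a ((F ^ (n : ℤ)) (γ t)) = a₀ + n * a (latticePoint w)) :
    |b ((F ^ (n : ℤ)) (γ t)) - b (γ s) - n * b (latticePoint w)| ≤ 80 * E := by
  have h1 := hG.le_of_translated hF hC hab hsurj hγ hMa hMb hE hME hN hEW hs₀ hs₁ hB hx hn ha₀ hs ht
  have hG' : IsRoughGraph F a (-b) γ N m W E := fun n hn a₀ ha₀ s t hs ht => by
    have := hG n hn a₀ ha₀ t s ht hs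
    simp only [neg_apply]
    linarith
  have h2 := hG'.le_of_translated hF hC (fun x hx hx' => hab x hx (by simpa using hx'))
    (fun u v => by
      obtain ⟨x, hx, hx'⟩ := hsurj u (-v)
      exact ⟨x, hx, by simp [hx']⟩)
    hγ hMa (by rwa [norm_neg]) hE hME hN hEW hs₀ hs₁
    (fun s => by simpa using hB s) hx hn ha₀ hs ht
  simp only [neg_apply] at h2
  rw [abs_le]
  constructor <;> linarith

theorem IsRoughGraph.abs_shift_le (hG : IsRoughGraph F a b γ N m W E) {B : ℝ}
    (hB : ∀ s, |b (γ s)| ≤ B) {x y : ℝ × ℝ} (hy : F y = y) {w : ℤ × ℤ}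
    (hx : F x = x + latticePoint w) {n : ℕ} (hn : n ≤ N) {a₀ : ℝ} (ha₀ : |a₀ - m| ≤ W / 32)
    {s s' : ℝ} (hs : a (γ s) = a₀) (hs' : a (γ s') = a₀ + n * a (latticePoint w)) :
    |b (γ s') - b (γ s) - n * b (latticePoint w)| ≤ 160 * E := by
  have hW : 0 ≤ W := by linarith [(norm_nonneg a).trans hMa]
  have haw := abs_le.1 (natCast_mul_abs_map_le hC hMa hx hn)
  have ha₀' := abs_le.1 ha₀
  have hc : Continuous fun t => a ((F ^ (n : ℤ)) (γ t)) :=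
    a.continuous.comp ((F ^ (n : ℤ)).continuous.comp hγ)
  obtain ⟨t, ht⟩ : ∃ t, a ((F ^ (n : ℤ)) (γ t)) = a₀ + n * a (latticePoint w) := by
    refine mem_range_of_exists_le_of_exists_ge hc ⟨s₀, ?_⟩ ⟨s₁, ?_⟩
    · have := abs_le.1 (abs_map_zpow_apply_sub_le hC hMa hn (γ s₀))
      linarith
    · have := abs_le.1 (abs_map_zpow_apply_sub_le hC hMa hn (γ s₁))
      linarith
  have hz : latticePoint 0 = 0 := by simp [latticePoint]
  have h1 := hG.abs_le_of_translated hF hC hab hsurj hγ hMa hMb hE hME hN hEW hs₀ hs₁ hB hx hn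
    (by linarith) hs ht
  have h2 := hG.abs_le_of_translated hF hC hab hsurj hγ hMa hMb hE hME hN hEW hs₀ hs₁ hB
    (x := y) (w := 0) (by rw [hy, hz, add_zero]) hn
    (a₀ := a₀ + n * a (latticePoint w)) (by rw [abs_le]; constructor <;> linarith) hs'
    (by rw [hz, map_zero, mul_zero, add_zero, ht])
  rw [hz, map_zero, mul_zero, sub_zero] at h2
  rw [abs_le] at *
  constructor <;> linarith

theorem IsRoughGraph.abs_int_shift_le (hG : IsRoughGraph F a b γ N m W E) {B : ℝ}
    (hB : ∀ s, |b (γ s)| ≤ B) {x y : ℝ × ℝ} (hy : F y = y) {w : ℤ × ℤ}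
    (hx : F x = x + latticePoint w) {z : ℤ} (hz : |z| ≤ N)
    {s s' : ℝ} (hs : a (γ s) = m) (hs' : a (γ s') = m + z * a (latticePoint w)) :
    |b (γ s') - b (γ s) - z * b (latticePoint w)| ≤ 160 * E := by
  have hW : 0 ≤ W := by linarith [(norm_nonneg a).trans hMa]
  obtain ⟨n, rfl | rfl⟩ := z.eq_nat_or_neg
  · have hn : n ≤ N := by simpa using hz
    exact hG.abs_shift_le hF hC hab hsurj hγ hMa hMb hE hME hN hEW hs₀ hs₁ hB hy hx hn
      (by simpa using by positivity) hs (by simpa using hs')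
  · have hn : n ≤ N := by simpa using hz
    have haw := natCast_mul_abs_map_le hC hMa hx hn
    push_cast at hs' ⊢
    have h := hG.abs_shift_le hF hC hab hsurj hγ hMa hMb hE hME hN hEW hs₀ hs₁ hB hy hx hn
      (by rw [add_sub_cancel_left, neg_mul, abs_neg]; linarith) hs' (by rw [hs]; ring)
    rw [abs_le] at *
    constructor <;> linarith

/-- The rough graph is nearly invariant under integer translations in two independent directions,
which is impossible for a graph. -/
theorem IsRoughGraph.mul_abs_det_le (hG : IsRoughGraph F a b γ N m W E) {B : ℝ}
    (hB : ∀ s, |b (γ s)| ≤ B) {x y z : ℝ × ℝ} (hy : F y = y) {w w' : ℤ × ℤ}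
    (hx : F x = x + latticePoint w) (hz : F z = z + latticePoint w') {α α' : ℤ}
    (hα : a (latticePoint w) = α) (hα' : a (latticePoint w') = α') {T : ℕ}
    (hT : |T * α| ≤ N) (hT' : |T * α'| ≤ N) :
    T * |α' * b (latticePoint w) - α * b (latticePoint w')| ≤ 320 * E := by
  have hW : 0 ≤ W := by linarith [(norm_nonneg a).trans hMa]
  have hc : Continuous fun t => a (γ t) := a.continuous.comp hγ
  obtain ⟨s, hs⟩ : ∃ s, a (γ s) = m := mem_range_of_exists_le_of_exists_ge hc
    ⟨s₀, by linarith⟩ ⟨s₁, by linarith⟩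
  have hbd' : |((T * α' : ℤ) : ℝ) * α| ≤ M * C * N := by
    have := natCast_mul_abs_map_le hC hMa hx (n := (T * α').natAbs) (N := N) (by zify; exact hT')
    rwa [abs_mul, hα, Nat.abs_cast, Nat.cast_natAbs, Int.cast_abs, ← abs_mul] at this
  rw [abs_le] at hbd'
  obtain ⟨s', hs'⟩ : ∃ s, a (γ s) = m + ((T * α' : ℤ) : ℝ) * α :=
    mem_range_of_exists_le_of_exists_ge hc ⟨s₀, by linarith⟩ ⟨s₁, by linarith⟩
  have h1 := hG.abs_int_shift_le hF hC hab hsurj hγ hMa hMb hE hME hN hEW hs₀ hs₁ hB hy hx hT' hs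
    (by rw [hs', hα])
  have h2 := hG.abs_int_shift_le hF hC hab hsurj hγ hMa hMb hE hME hN hEW hs₀ hs₁ hB hy hz hT hs
    (by rw [hs', hα']; push_cast; ring)
  have hT0 : (T : ℝ) * |α' * b (latticePoint w) - α * b (latticePoint w')| =
      |((T * α' : ℤ) : ℝ) * b (latticePoint w) - ((T * α : ℤ) : ℝ) * b (latticePoint w')| := by
    rw [← Nat.abs_cast T, ← abs_mul]
    push_cast
    congr 1
    ring
  rw [hT0]
  rw [abs_le] at *
  constructor <;> linarith

end

/-- The orbit segments of length `J` before and after `p` fall short of the maximal displacement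
in the direction of `ν` by `J / 4`. -/
def IsDeficient (F : (ℝ × ℝ) ≃ₜ (ℝ × ℝ)) (J : ℕ) (ν : ℝ × ℝ →L[ℝ] ℝ) (p : ℝ × ℝ) : Prop :=
  ν ((F ^ (J : ℤ)) p - p) + J / 4 ≤ maxDisplacement F ν J ∧
    ν (p - (F ^ (-(J : ℤ))) p) + J / 4 ≤ maxDisplacement F ν J

theorem abs_map_sub_le_of_norm_le {ν : ℝ × ℝ →L[ℝ] ℝ} {M S : ℝ} (hν : ‖ν‖ ≤ M) {x y : ℝ × ℝ}
    (h : ‖x - y‖ ≤ S) : |ν x - ν y| ≤ M * S := by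
  rw [← map_sub]
  exact (ν.le_opNorm _).trans (mul_le_mul hν h (norm_nonneg _) ((norm_nonneg _).trans hν))

section

variable {F : (ℝ × ℝ) ≃ₜ (ℝ × ℝ)} {C : ℝ}
  (hF : ∀ x k, F (x + latticePoint k) = F x + latticePoint k) (hC : ∀ x, ‖F x - x‖ ≤ C)

include hF hC

theorem isRoughGraph_of_isDeficient {a b : ℝ × ℝ →L[ℝ] ℝ} (hab : ∀ x, a x = 0 → b x = 0 → x = 0)
    (hsurj : ∀ u v, ∃ x, a x = u ∧ b x = v) {γ : ℝ → ℝ × ℝ} (hγ : Continuous γ)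
    {M S E W m : ℝ} {J N : ℕ} (hMa : ‖a‖ ≤ M) (hMb : ‖b‖ ≤ M) (hMX : ‖a + b‖ ≤ M)
    (hMY : ‖a - b‖ ≤ M) (hE : 0 < E) (hME : M ≤ E) (hN : M * C * N ≤ W / 64) (hEW : 64 * E ≤ W)
    (hS : ∀ s t, ‖γ s - γ t‖ ≤ S)
    (hJ : ∀ s t, ‖(F ^ (J : ℤ)) (γ s) - (F ^ (J : ℤ)) (γ t)‖ ≤ S)
    (hJ' : ∀ s t, ‖(F ^ (-(J : ℤ))) (γ s) - (F ^ (-(J : ℤ))) (γ t)‖ ≤ S)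
    {s₀ s₁ s' : ℝ} (hs₀ : a (γ s₀) = m - W / 2) (hs₁ : a (γ s₁) = m + W / 2)
    (hb : ∀ s t, b (γ s) - b (γ t) ≤ W / 16)
    (hD : ∀ ν ∈ ({a + b, -(a + b), a - b, -(a - b)} : Set (ℝ × ℝ →L[ℝ] ℝ)),
      2 * maxDisplacement F ν J - maxDisplacement F ν (2 * J) + 1 ≤ E)
    (hX : IsDeficient F J (a + b) (γ s') ∨ IsDeficient F J (-(a + b)) (γ s'))
    (hY : IsDeficient F J (a - b) (γ s') ∨ IsDeficient F J (-(a - b)) (γ s'))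
    (hslack : 3 * M * S + M * C * N + 10 * E < J / 4) :
    IsRoughGraph F a b γ N m W E := by
  intro n hn a₀ ha₀ s t hs ht
  by_contra! hcon
  set ρ : ℝ → ℝ × ℝ := fun s => (F ^ (n : ℤ)) (γ s) with hρ
  set b₀ := (b (ρ s) + b (ρ t)) / 2 with hb₀
  have hdispl : ∀ ν : ℝ × ℝ →L[ℝ] ℝ, ‖ν‖ ≤ M → ∀ y, |ν ((F ^ (n : ℤ)) y) - ν y| ≤ W / 64 :=
    fun ν hν y => (abs_map_zpow_apply_sub_le hC hν hn y).trans hN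
  have hWS : W ≤ M * S := by
    have := abs_le.1 (abs_map_sub_le_of_norm_le hMa (hS s₁ s₀))
    linarith
  have hbρ : ∀ r r', b (ρ r) - b (ρ r') ≤ W / 16 + W / 32 := fun r r' => by
    have h1 := abs_le.1 (hdispl b hMb (γ r))
    have h2 := abs_le.1 (hdispl b hMb (γ r'))
    have h3 := hb r r'
    simp only [hρ]
    linarith
  have hb₀' : ∀ r, |b₀ - b (γ r)| ≤ W / 16 + W / 64 := fun r => by
    have h1 := abs_le.1 (hdispl b hMb (γ s))
    have h2 := abs_le.1 (hdispl b hMb (γ t))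
    have h3 := hb s r
    have h4 := hb t r
    have h5 := hb r s
    have h6 := hb r t
    simp only [hb₀, hρ]
    rw [abs_le]
    constructor <;> linarith
  rw [abs_le] at ha₀ hs ht
  have hx₁ : |(a₀ + b₀) - (a + b) (γ s')| ≤ 2 * M * S := by
    have h1 := abs_le.1 (hb₀' s')
    have h2 := abs_le.1 (abs_map_sub_le_of_norm_le hMa (hS s₀ s'))
    rw [add_apply, abs_le]
    constructor <;> linarith
  have hx₂ : |(a₀ - b₀) - (a - b) (γ s')| ≤ 2 * M * S := by
    have h1 := abs_le.1 (hb₀' s')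
    have h2 := abs_le.1 (abs_map_sub_le_of_norm_le hMa (hS s₀ s'))
    rw [sub_apply, abs_le]
    constructor <;> linarith
  have hslow : ∀ (ν : ℝ × ℝ →L[ℝ] ℝ) (x₀ : ℝ), ‖ν‖ ≤ M → |x₀ - ν (γ s')| ≤ 2 * M * S →
      (IsDeficient F J ν (γ s') ∨ IsDeficient F J (-ν) (γ s')) →
      IsSlow F J ν ρ x₀ (10 * E) ∨ IsSlow F J (-ν) ρ (-x₀) (10 * E) := by
    intro ν x₀ hν hx₀ h
    refine h.imp (fun h => ?_) (fun h => ?_)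
    · exact isSlow_zpow_comp hC hν hJ hJ' h.1 h.2 hslack hn hx₀
    · exact isSlow_zpow_comp hC (by rwa [norm_neg]) hJ hJ' h.1 h.2 hslack hn
        (by rw [neg_apply, neg_sub_neg, abs_sub_comm]; exact hx₀)
  have hBd : ∀ ν : ℝ × ℝ →L[ℝ] ℝ, ‖ν‖ ≤ M →
      ∀ r, |ν (ρ r)| ≤ |(a + b) (γ s')| + |(a - b) (γ s')| + |ν (γ s')| + M * S + W / 64 := by
    intro ν hν r
    have h1 := abs_le.1 (hdispl ν hν (γ r))
    have h2 := abs_le.1 (abs_map_sub_le_of_norm_le hν (hS r s'))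
    have h3 := abs_nonneg ((a + b) (γ s'))
    have h4 := abs_nonneg ((a - b) (γ s'))
    have h5 := le_abs_self (ν (γ s'))
    have h6 := neg_abs_le (ν (γ s'))
    simp only [hρ]
    rw [abs_le]
    constructor <;> linarith
  refine not_meets_four_quadrants_of_isSlow hF hC (J := J) (X := a + b) (Y := a - b)
    (fun x h1 h2 => ?_) (fun u v => ?_) ((F ^ (n : ℤ)).continuous.comp hγ)
    (B := 2 * |(a + b) (γ s')| + 2 * |(a - b) (γ s')| + M * S + W / 64)
    (fun r => (hBd _ hMX r).trans ?_) (fun r => (hBd _ hMY r).trans ?_) hE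
    (hslow _ _ hMX hx₁ hX) (hslow _ _ hMY hx₂ hY) hD (hMX.trans hME) (hMY.trans hME)
    (s₁ := s₀) (s₂ := s₁) (s₃ := t) (s₄ := s) ?_ ?_ ?_ ?_
  · simp only [add_apply, sub_apply] at h1 h2
    exact hab x (by linarith) (by linarith)
  · obtain ⟨x, h1, h2⟩ := hsurj ((u + v) / 2) ((u - v) / 2)
    exact ⟨x, by rw [add_apply, h1, h2]; ring, by rw [sub_apply, h1, h2]; ring⟩
  · linarith [abs_nonneg ((a - b) (γ s'))]
  · linarith [abs_nonneg ((a + b) (γ s'))]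
  · have h1 := abs_le.1 (hdispl a hMa (γ s₀))
    have h2 := hbρ s₀ s
    have h3 := hbρ s₀ t
    have h4 := hbρ s s₀
    have h5 := hbρ t s₀
    simp only [Function.comp_apply, add_apply, sub_apply]
    simp only [hρ] at h2 h3 h4 h5 hb₀
    constructor <;> linarith
  · have h1 := abs_le.1 (hdispl a hMa (γ s₁))
    have h2 := hbρ s₁ s
    have h3 := hbρ s₁ t
    have h4 := hbρ s s₁
    have h5 := hbρ t s₁
    simp only [Function.comp_apply, add_apply, sub_apply]
    simp only [hρ] at h2 h3 h4 h5 hb₀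
    constructor <;> linarith
  · simp only [Function.comp_apply, add_apply, sub_apply]
    simp only [hρ] at hb₀
    constructor <;> linarith
  · simp only [Function.comp_apply, add_apply, sub_apply]
    simp only [hρ] at hb₀
    constructor <;> linarith

end

/-- The linear functional on the plane with integer coefficients `p`. -/
noncomputable def intFunctional (p : ℤ × ℤ) : ℝ × ℝ →L[ℝ] ℝ :=
  (p.1 : ℝ) • ContinuousLinearMap.fst ℝ ℝ ℝ + (p.2 : ℝ) • ContinuousLinearMap.snd ℝ ℝ ℝ

theorem intFunctional_apply (p : ℤ × ℤ) (x : ℝ × ℝ) :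
    intFunctional p x = p.1 * x.1 + p.2 * x.2 := by
  simp [intFunctional]

theorem intFunctional_add (p q : ℤ × ℤ) :
    intFunctional p + intFunctional q = intFunctional (p + q) := by
  refine ContinuousLinearMap.ext fun x => ?_
  simp only [add_apply, intFunctional_apply, Prod.fst_add, Prod.snd_add, Int.cast_add]
  ring

theorem intFunctional_neg (p : ℤ × ℤ) : -intFunctional p = intFunctional (-p) := by
  refine ContinuousLinearMap.ext fun x => ?_
  simp only [neg_apply, intFunctional_apply, Prod.fst_neg, Prod.snd_neg, Int.cast_neg]
  ring

theorem intFunctional_sub (p q : ℤ × ℤ) :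
    intFunctional p - intFunctional q = intFunctional (p - q) := by
  rw [sub_eq_add_neg, intFunctional_neg, intFunctional_add, ← sub_eq_add_neg]

theorem norm_intFunctional_le {p : ℤ × ℤ} {M : ℤ} (h : |p.1| + |p.2| ≤ M) :
    ‖intFunctional p‖ ≤ M := by
  have h' : |(p.1 : ℝ)| + |(p.2 : ℝ)| ≤ M := by exact_mod_cast h
  refine ContinuousLinearMap.opNorm_le_bound _ (le_trans (by positivity) h') fun x => ?_
  rw [intFunctional_apply, Real.norm_eq_abs]
  have h1 : |x.1| ≤ ‖x‖ := norm_fst_le x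
  have h2 : |x.2| ≤ ‖x‖ := norm_snd_le x
  calc |p.1 * x.1 + p.2 * x.2| ≤ |(p.1 : ℝ)| * |x.1| + |(p.2 : ℝ)| * |x.2| := by
        rw [← abs_mul, ← abs_mul]; exact abs_add_le _ _
    _ ≤ |(p.1 : ℝ)| * ‖x‖ + |(p.2 : ℝ)| * ‖x‖ := by gcongr
    _ = (|(p.1 : ℝ)| + |(p.2 : ℝ)|) * ‖x‖ := by ring
    _ ≤ M * ‖x‖ := by gcongr

theorem exists_intFunctional_eq {p q : ℤ × ℤ} (h : p.1 * q.2 - p.2 * q.1 ≠ 0) (u v : ℝ) :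
    ∃ x, intFunctional p x = u ∧ intFunctional q x = v := by
  have h' : (p.1 : ℝ) * q.2 - p.2 * q.1 ≠ 0 := by exact_mod_cast h
  refine ⟨((u * q.2 - p.2 * v) / (p.1 * q.2 - p.2 * q.1),
    (p.1 * v - u * q.1) / (p.1 * q.2 - p.2 * q.1)), ?_, ?_⟩ <;>
  · rw [intFunctional_apply]
    rw [← mul_div_assoc, ← mul_div_assoc, ← add_div, div_eq_iff h']
    ring

theorem eq_zero_of_intFunctional_eq_zero {p q : ℤ × ℤ} (h : p.1 * q.2 - p.2 * q.1 ≠ 0) (x : ℝ × ℝ)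
    (hp : intFunctional p x = 0) (hq : intFunctional q x = 0) : x = 0 := by
  have h' : (p.1 : ℝ) * q.2 - p.2 * q.1 ≠ 0 := by exact_mod_cast h
  rw [intFunctional_apply] at hp hq
  ext
  · refine (mul_eq_zero.1 (?_ : _ * x.1 = 0)).resolve_left h'
    linear_combination q.2 * hp - p.2 * hq
  · refine (mul_eq_zero.1 (?_ : _ * x.2 = 0)).resolve_left h'
    linear_combination p.1 * hq - q.1 * hp

/-- Functionals of which the first is large and nearly vanishes on `d`. -/
theorem exists_adapted_functionals (d : ℝ × ℝ) (n : ℕ) :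
    ∃ p q w : ℤ × ℤ, (w = (1, 0) ∨ w = (0, 1)) ∧ |p.1| + |p.2| ≤ 2 * n ∧ |q.1| + |q.2| ≤ 1 ∧
      |p.1 * q.2 - p.2 * q.1| = n ∧ |intFunctional p d| ≤ ‖d‖ ∧
      |intFunctional p (latticePoint w)| = n ∧ intFunctional q (latticePoint w) = 0 ∧
      ∀ v, n * ‖v‖ ≤ |intFunctional p v| + n * |intFunctional q v| := by
  have key : ∀ s t : ℝ, |t| ≤ |s| → ∃ r : ℤ, |r| ≤ n ∧ |n * t - r * s| ≤ |s| := by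
    intro s t hts
    rcases eq_or_ne s 0 with rfl | hs
    · refine ⟨0, by simp, ?_⟩
      obtain rfl : t = 0 := by simpa using hts
      simp
    have hs' : 0 < |s| := abs_pos.2 hs
    refine ⟨round (n * t / s), ?_, ?_⟩
    · have h : |n * t / s| ≤ n := by
        rw [abs_div, abs_mul, Nat.abs_cast, div_le_iff₀ hs']
        gcongr
      have h2 := abs_le.1 (abs_sub_round (n * t / s))
      have h3 := abs_le.1 h
      have h4 : ((round (n * t / s) : ℤ) : ℝ) < ((n + 1 : ℤ) : ℝ) := by push_cast; linarith
      have h5 : ((-(n + 1) : ℤ) : ℝ) < ((round (n * t / s) : ℤ) : ℝ) := by push_cast; linarith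
      rw [Int.cast_lt] at h4 h5
      rw [abs_le]
      constructor <;> linarith
    · have h : n * t - round (n * t / s) * s = (n * t / s - round (n * t / s)) * s := by
        field_simp
      rw [h, abs_mul]
      nlinarith [abs_sub_round (n * t / s)]
  have habs : ∀ (r : ℤ) (u v : ℝ), |r| ≤ n → |(r : ℝ) * u| ≤ n * |u| := fun r u v hr => by
    rw [abs_mul]
    gcongr
    exact_mod_cast hr
  rcases le_total |d.2| |d.1| with h | h
  · obtain ⟨r, hr, hrd⟩ := key _ _ h
    refine ⟨(-r, n), (1, 0), (0, 1), by simp, ?_, by simp, by simp, ?_, ?_, ?_, fun v => ?_⟩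
    · rw [abs_neg, Nat.abs_cast]; linarith
    · rw [intFunctional_apply]
      refine le_trans (le_of_eq ?_) (hrd.trans (norm_fst_le d))
      congr 1; push_cast; ring
    · simp [intFunctional_apply, latticePoint]
    · simp [intFunctional_apply, latticePoint]
    · simp only [intFunctional_apply]
      push_cast
      rw [one_mul, zero_mul, add_zero, Prod.norm_def, Real.norm_eq_abs, Real.norm_eq_abs]
      have h1 := habs r v.1 0 hr
      have h2 := abs_add_le (-(r : ℝ) * v.1 + n * v.2) (r * v.1)
      rw [show -(r : ℝ) * v.1 + n * v.2 + r * v.1 = n * v.2 by ring, abs_mul, Nat.abs_cast] at h2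
      rcases max_cases |v.1| |v.2| with ⟨h3, -⟩ | ⟨h3, -⟩ <;> rw [h3]
      · linarith [abs_nonneg (-(r : ℝ) * v.1 + n * v.2)]
      · linarith
  · obtain ⟨r, hr, hrd⟩ := key _ _ h
    refine ⟨(n, -r), (0, 1), (1, 0), by simp, ?_, by simp, by simp, ?_, ?_, ?_, fun v => ?_⟩
    · rw [abs_neg, Nat.abs_cast]; linarith
    · rw [intFunctional_apply]
      refine le_trans (le_of_eq ?_) (hrd.trans (norm_snd_le d))
      congr 1; push_cast; ring
    · simp [intFunctional_apply, latticePoint]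
    · simp [intFunctional_apply, latticePoint]
    · simp only [intFunctional_apply]
      push_cast
      rw [one_mul, zero_mul, zero_add, Prod.norm_def, Real.norm_eq_abs, Real.norm_eq_abs]
      have h1 := habs r v.2 0 hr
      have h2 := abs_add_le ((n : ℝ) * v.1 + -r * v.2) (r * v.2)
      rw [show (n : ℝ) * v.1 + -r * v.2 + r * v.2 = n * v.1 by ring, abs_mul, Nat.abs_cast] at h2
      rcases max_cases |v.1| |v.2| with ⟨h3, -⟩ | ⟨h3, -⟩ <;> rw [h3]
      · linarith
      · linarith [abs_nonneg ((n : ℝ) * v.1 + -r * v.2)]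

section

variable {F : (ℝ × ℝ) ≃ₜ (ℝ × ℝ)} {C : ℝ}
  (hF : ∀ x k, F (x + latticePoint k) = F x + latticePoint k) (hC : ∀ x, ‖F x - x‖ ≤ C)

include hF hC

theorem isDeficient_or_isDeficient_neg {J : ℕ} {ν : ℝ × ℝ →L[ℝ] ℝ} {p x y : ℝ × ℝ} {w : ℤ × ℤ}
    (hy : F y = y) (hx : F x = x + latticePoint w)
    (h : |ν ((F ^ (J : ℤ)) p - p) - ν (p - (F ^ (-(J : ℤ))) p)| + J / 2 ≤
      J * |ν (latticePoint w)|) :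
    IsDeficient F J ν p ∨ IsDeficient F J (-ν) p := by
  have h0 : latticePoint 0 = 0 := by simp [latticePoint]
  have hFy : (F ^ (J : ℤ)) y = y := by
    simpa [h0] using natPow_apply_of_translated hF (w := 0) (by rw [hy, h0, add_zero]) 0 J
  have hFx : (F ^ (J : ℤ)) x = x + (J : ℝ) • latticePoint w := by
    simpa [h0] using natPow_apply_of_translated hF hx 0 J
  have e1 := le_maxDisplacement hC ν J y
  have e2 := le_maxDisplacement hC (-ν) J y
  have e3 := le_maxDisplacement hC ν J x
  have e4 := le_maxDisplacement hC (-ν) J x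
  simp only [hFy, hFx, sub_self, map_zero, add_sub_cancel_left, map_smul, smul_eq_mul,
    neg_apply] at e1 e2 e3 e4
  have e5 : J * |ν (latticePoint w)| ≤ maxDisplacement F ν J + maxDisplacement F (-ν) J := by
    rcases abs_cases (ν (latticePoint w)) with ⟨h, -⟩ | ⟨h, -⟩ <;> rw [h] <;> linarith
  by_contra! hcon
  simp only [IsDeficient, not_and_or, not_le, neg_apply] at hcon
  have h1 := neg_abs_le (ν ((F ^ (J : ℤ)) p - p) - ν (p - (F ^ (-(J : ℤ))) p))
  have h2 := le_abs_self (ν ((F ^ (J : ℤ)) p - p) - ν (p - (F ^ (-(J : ℤ))) p))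
  obtain ⟨h3 | h3, h4 | h4⟩ := hcon <;> linarith

end

/-- Every path of diameter at least `R` is stretched to diameter `K * R` within bounded time. -/
def IsExpanding (F : (ℝ × ℝ) ≃ₜ (ℝ × ℝ)) (K : ℝ) : Prop :=
  ∃ R : ℝ, 0 < R ∧ ∃ J : ℕ, ∀ γ : ℝ → ℝ × ℝ, Continuous γ → ∀ α β, α ≤ β →
    R ≤ ‖γ α - γ β‖ → ∃ j : ℤ, |j| ≤ J ∧ ∃ s ∈ Set.Icc α β, ∃ t ∈ Set.Icc α β,
      K * R ≤ ‖(F ^ j) (γ s) - (F ^ j) (γ t)‖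

section

variable {F : (ℝ × ℝ) ≃ₜ (ℝ × ℝ)}
  (hF : ∀ x k, F (x + latticePoint k) = F x + latticePoint k) {C : ℕ} (hC1 : 1 ≤ C)
  (hC : ∀ x, ‖F x - x‖ ≤ C) {y x₁ x₂ : ℝ × ℝ} (hy : F y = y)
  (hx₁ : F x₁ = x₁ + latticePoint (1, 0)) (hx₂ : F x₂ = x₂ + latticePoint (0, 1))

include hF hC1 hC hy hx₁ hx₂

theorem exists_lt_norm_zpow_apply_sub {M t : ℕ} (hM1 : 1 ≤ M) (ht : 640 * M ≤ t) {p q : ℤ × ℤ}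
    (hpq : p.1 * q.2 - p.2 * q.1 ≠ 0) (hp : |p.1| + |p.2| ≤ M) (hq : |q.1| + |q.2| ≤ M)
    (hadd : |(p + q).1| + |(p + q).2| ≤ M) (hsub : |(p - q).1| + |(p - q).2| ≤ M)
    (hD : ∀ r : ℤ × ℤ, |r.1| + |r.2| ≤ M →
      2 * maxDisplacement F (intFunctional r) (96 * M ^ 3 * C * t) -
        maxDisplacement F (intFunctional r) (2 * (96 * M ^ 3 * C * t)) + 1 ≤ (t : ℝ) / 640)
    {γ : ℝ → ℝ × ℝ} (hγ : Continuous γ) {s₀ s₁ s' : ℝ}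
    (hW : 64 * (M ^ 2 * C * t : ℝ) ≤ intFunctional p (γ s₁) - intFunctional p (γ s₀))
    (hb : ∀ s t, intFunctional q (γ s) - intFunctional q (γ t) ≤
      (intFunctional p (γ s₁) - intFunctional p (γ s₀)) / 16)
    (hX : IsDeficient F (96 * M ^ 3 * C * t) (intFunctional (p + q)) (γ s') ∨
      IsDeficient F (96 * M ^ 3 * C * t) (-intFunctional (p + q)) (γ s'))
    (hY : IsDeficient F (96 * M ^ 3 * C * t) (intFunctional (p - q)) (γ s') ∨
      IsDeficient F (96 * M ^ 3 * C * t) (-intFunctional (p - q)) (γ s')) :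
    ∃ j : ℤ, |j| ≤ (96 * M ^ 3 * C * t : ℕ) ∧ ∃ s s',
      4 * (M ^ 2 * C * t : ℝ) < ‖(F ^ j) (γ s) - (F ^ j) (γ s')‖ := by
  by_contra! hcon
  set J := 96 * M ^ 3 * C * t with hJ
  have hM1' : (1 : ℝ) ≤ M := by exact_mod_cast hM1
  have hC1' : (1 : ℝ) ≤ C := by exact_mod_cast hC1
  have ht' : 640 * (M : ℝ) ≤ t := by exact_mod_cast ht
  have ht0 : (0 : ℝ) < t := by linarith
  have hMCt : (t : ℝ) ≤ M ^ 2 * C * t := by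
    have : (1 : ℝ) ≤ M ^ 2 * C := one_le_mul_of_one_le_of_one_le (one_le_pow₀ hM1') hC1'
    nlinarith
  have hMMCt : (M : ℝ) ^ 2 * C * t ≤ M * (M ^ 2 * C * t) := by nlinarith
  have hJ' : (J : ℝ) = 96 * (M * (M ^ 2 * C * t)) := by rw [hJ]; push_cast; ring
  have hSJ : ∀ j : ℤ, |j| ≤ J → ∀ s s', ‖(F ^ j) (γ s) - (F ^ j) (γ s')‖ ≤ 4 * (M ^ 2 * C * t) :=
    fun j hj => hcon j hj
  have hpM := norm_intFunctional_le hp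
  have hqM := norm_intFunctional_le hq
  have haM := norm_intFunctional_le hadd
  have hsM := norm_intFunctional_le hsub
  rw [Int.cast_natCast] at hpM hqM haM hsM
  have hab := fun x => eq_zero_of_intFunctional_eq_zero hpq x
  have hsurj := exists_intFunctional_eq hpq
  have hN : (M : ℝ) * C * ((M * t : ℕ) : ℝ) ≤
      (intFunctional p (γ s₁) - intFunctional p (γ s₀)) / 64 := by
    push_cast
    linarith
  have hE : (0 : ℝ) < t / 640 := by positivity
  have hME : (M : ℝ) ≤ t / 640 := by linarith
  have hEW : 64 * ((t : ℝ) / 640) ≤ intFunctional p (γ s₁) - intFunctional p (γ s₀) := by linarith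
  have hs₀ : intFunctional p (γ s₀) = (intFunctional p (γ s₀) + intFunctional p (γ s₁)) / 2 -
      (intFunctional p (γ s₁) - intFunctional p (γ s₀)) / 2 := by ring
  have hs₁ : intFunctional p (γ s₁) = (intFunctional p (γ s₀) + intFunctional p (γ s₁)) / 2 +
      (intFunctional p (γ s₁) - intFunctional p (γ s₀)) / 2 := by ring
  have hS0 := hSJ 0 (by simp)
  have hG := isRoughGraph_of_isDeficient hF hC (J := J) hab hsurj hγ hpM hqM
    (by rwa [intFunctional_add]) (by rwa [intFunctional_sub]) hE hME hN hEW
    (S := 4 * (M ^ 2 * C * t)) (fun s s' => hS0 s s')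
    (hSJ J (by simp)) (hSJ (-J) (by simp)) hs₀ hs₁ hb
    (by
      intro ν hν
      simp only [intFunctional_add, intFunctional_sub, intFunctional_neg, Set.mem_insert_iff,
        Set.mem_singleton_iff] at hν
      rcases hν with rfl | rfl | rfl | rfl
      · exact hD _ hadd
      · exact hD _ (by simpa only [Prod.fst_neg, Prod.snd_neg, abs_neg] using hadd)
      · exact hD _ hsub
      · exact hD _ (by simpa only [Prod.fst_neg, Prod.snd_neg, abs_neg] using hsub))
    (by rwa [intFunctional_add]) (by rwa [intFunctional_sub])
    (by
      rw [hJ']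
      push_cast
      nlinarith)
  have hB : ∀ s, |intFunctional q (γ s)| ≤ |intFunctional q (γ 0)| + M * (4 * (M ^ 2 * C * t)) := by
    intro s
    have h1 := abs_map_sub_le_of_norm_le hqM (hS0 s 0)
    have h2 := abs_add_le (intFunctional q (γ s) - intFunctional q (γ 0)) (intFunctional q (γ 0))
    rw [sub_add_cancel] at h2
    have h3 : |intFunctional q (γ s) - intFunctional q (γ 0)| ≤ M * (4 * (M ^ 2 * C * t)) := h1
    linarith
  have hval : ∀ r : ℤ × ℤ, intFunctional r (latticePoint (1, 0)) = r.1 ∧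
      intFunctional r (latticePoint (0, 1)) = r.2 := fun r => by
    simp [intFunctional_apply, latticePoint]
  have hfin := hG.mul_abs_det_le hF hC hab hsurj hγ hpM hqM hE hME hN hEW hs₀ hs₁ hB hy hx₁ hx₂
    (hval p).1 (hval p).2 (T := t)
    (by
      rw [abs_mul, Nat.abs_cast]
      push_cast
      nlinarith [abs_nonneg p.2])
    (by
      rw [abs_mul, Nat.abs_cast]
      push_cast
      nlinarith [abs_nonneg p.1])
  rw [(hval q).1, (hval q).2] at hfin
  have hdet : (1 : ℝ) ≤ |(p.2 : ℝ) * q.1 - p.1 * q.2| := by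
    rw [abs_sub_comm]
    exact_mod_cast Int.one_le_abs hpq
  nlinarith

set_option maxHeartbeats 600000 in
/-- The key geometric fact: long paths are stretched. -/
theorem isExpanding_of_fixed {K : ℕ} (hK : 1 ≤ K) : IsExpanding F K := by
  set m := 512 * K with hm
  set n := 2 * C * (m + 1) + 1 + 32 * K with hn
  set M := m + 2 * n with hM
  have hM1 : 1 ≤ M := by omega
  have hM1' : (1 : ℝ) ≤ M := by exact_mod_cast hM1
  have hC1' : (1 : ℝ) ≤ C := by exact_mod_cast hC1
  have hK1' : (1 : ℝ) ≤ K := by exact_mod_cast hK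
  have hev : ∀ r ∈ (Finset.Icc (-(M : ℤ), -(M : ℤ)) (M, M) : Set (ℤ × ℤ)), ∀ᶠ t : ℕ in atTop,
      2 * maxDisplacement F (intFunctional r) (96 * M ^ 3 * C * t) -
        maxDisplacement F (intFunctional r) (2 * (96 * M ^ 3 * C * t)) + 1 ≤ (t : ℝ) / 640 := by
    intro r _
    have hη : (0 : ℝ) < 1 / (640 * (96 * M ^ 3 * C)) := by positivity
    have htend : Tendsto (fun t : ℕ => 96 * M ^ 3 * C * t) atTop atTop :=
      Filter.tendsto_id.const_mul_atTop' (by positivity)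
    refine (htend.eventually
      (eventually_two_mul_maxDisplacement_le hC (intFunctional r) hη)).mono fun t ht => ?_
    refine ht.trans (le_of_eq ?_)
    push_cast
    field_simp
  obtain ⟨t, hDt, ht⟩ := (((Filter.eventually_all_finite (Finset.finite_toSet _)).2 hev).and
    (eventually_ge_atTop (640 * M))).exists
  have hD : ∀ r : ℤ × ℤ, |r.1| + |r.2| ≤ M →
      2 * maxDisplacement F (intFunctional r) (96 * M ^ 3 * C * t) -
        maxDisplacement F (intFunctional r) (2 * (96 * M ^ 3 * C * t)) + 1 ≤ (t : ℝ) / 640 := by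
    intro r hr
    refine hDt r ?_
    have h1 := abs_nonneg r.1
    have h2 := abs_nonneg r.2
    have h3 := abs_le.1 (show |r.1| ≤ M by linarith)
    have h4 := abs_le.1 (show |r.2| ≤ M by linarith)
    simp only [Finset.coe_Icc, Set.mem_Icc, Prod.le_def]
    exact ⟨⟨h3.1, h4.1⟩, h3.2, h4.2⟩
  set J := 96 * M ^ 3 * C * t with hJ
  have ht' : 640 * (M : ℝ) ≤ t := by exact_mod_cast ht
  have ht0 : (0 : ℝ) < t := by linarith
  set S : ℝ := 4 * (M ^ 2 * C * t) with hS
  have hS0 : 0 < S := by positivity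
  refine ⟨S / K, by positivity, J, fun γ hγ α β hαβ hγαβ => ?_⟩
  by_contra! hcon
  rw [mul_div_cancel₀ _ (by positivity)] at hcon
  set σ : ℝ → ℝ × ℝ := fun s => γ (Set.projIcc α β hαβ s) with hσ
  have hσc : Continuous σ := hγ.comp (continuous_subtype_val.comp continuous_projIcc)
  have hσS : ∀ j : ℤ, |j| ≤ J → ∀ s s', ‖(F ^ j) (σ s) - (F ^ j) (σ s')‖ < S := fun j hj s s' =>
    hcon j hj _ (Set.projIcc α β hαβ s).2 _ (Set.projIcc α β hαβ s').2
  have hσS0 : ∀ s s', ‖σ s - σ s'‖ < S := hσS 0 (by simp)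
  have hσα : σ α = γ α := by simp [hσ]
  have hσβ : σ β = γ β := by simp [hσ]
  set P := (F ^ (J : ℤ)) (σ α) - σ α with hP
  set P' := σ α - (F ^ (-(J : ℤ))) (σ α) with hP'
  have hPP : ‖P - P'‖ ≤ 2 * (C * J) := by
    have h1 := norm_zpow_apply_sub_le hC J (σ α)
    have h2 := norm_zpow_apply_sub_le hC (-J) (σ α)
    rw [norm_sub_rev] at h2
    simp only [Int.cast_neg, Int.cast_natCast, abs_neg, Nat.abs_cast] at h1 h2
    linarith [norm_sub_le P P']
  obtain ⟨p, q, w, hw, hp, hq, hdet, hpd, hpw, hqw, hv⟩ := exists_adapted_functionals (P - P') n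
  have hn0 : 0 < n := by omega
  have hn0' : (0 : ℝ) < n := by exact_mod_cast hn0
  have hn' : (n : ℝ) = 2 * C * (m + 1) + 1 + 32 * K := by rw [hn]; push_cast; ring
  have hm' : (m : ℝ) = 512 * K := by rw [hm]; push_cast; ring
  have hJ0 : (0 : ℝ) ≤ J := Nat.cast_nonneg _
  obtain ⟨x, hx⟩ : ∃ x, F x = x + latticePoint w := by
    rcases hw with rfl | rfl
    · exact ⟨_, hx₁⟩
    · exact ⟨_, hx₂⟩
  have hq1 := norm_intFunctional_le hq
  rw [Int.cast_one] at hq1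
  have hqd : ∀ v, |intFunctional q v| ≤ ‖v‖ := fun v =>
    ((intFunctional q).le_opNorm v).trans (by nlinarith [norm_nonneg v])
  have hdef : ∀ r : ℤ × ℤ, |intFunctional r (P - P')| ≤ (m + 1) * ‖P - P'‖ →
      |intFunctional r (latticePoint w)| = n →
      IsDeficient F J (intFunctional r) (σ α) ∨ IsDeficient F J (-intFunctional r) (σ α) := by
    intro r hr hrw
    refine isDeficient_or_isDeficient_neg hF hC hy hx ?_
    rw [hrw, ← map_sub]
    calc |intFunctional r (P - P')| + J / 2 ≤ (m + 1) * (2 * (C * J)) + J / 2 := by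
          gcongr
          exact hr.trans (by gcongr)
      _ ≤ J * n := by
        rw [hn']
        nlinarith
  have hscale : ∀ v, intFunctional ((m : ℤ) • q) v = m * intFunctional q v := fun v => by
    simp only [intFunctional_apply, Prod.smul_fst, Prod.smul_snd, smul_eq_mul]
    push_cast
    ring
  have hd0 := norm_nonneg (P - P')
  have hm0 : (0 : ℝ) ≤ m := Nat.cast_nonneg _
  by_cases hcase : ∃ s s', 16 * S ≤ intFunctional p (σ s') - intFunctional p (σ s)
  · obtain ⟨s₀, s₁, hs⟩ := hcase
    obtain ⟨j, hj, s, s', hlt⟩ := exists_lt_norm_zpow_apply_sub hF hC1 hC hy hx₁ hx₂ hM1 ht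
      (p := p) (q := q) (by rintro h; rw [h, abs_zero] at hdet; omega) (by push_cast [hM]; omega)
      (by push_cast [hM]; omega)
      (by
        have h1 := abs_add_le p.1 q.1
        have h2 := abs_add_le p.2 q.2
        simp only [Prod.fst_add, Prod.snd_add]
        push_cast [hM]; omega)
      (by
        have h1 := abs_sub p.1 q.1
        have h2 := abs_sub p.2 q.2
        simp only [Prod.fst_sub, Prod.snd_sub]
        push_cast [hM]; omega)
      hD hσc (s₀ := s₀) (s₁ := s₁) (s' := α) (by linarith)
      (fun s s' => by
        have h1 := hqd (σ s - σ s')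
        rw [map_sub] at h1
        linarith [le_abs_self (intFunctional q (σ s) - intFunctional q (σ s')), hσS0 s s'])
      (hdef _ (by
        rw [← intFunctional_add, add_apply]
        have h1 := abs_add_le (intFunctional p (P - P')) (intFunctional q (P - P'))
        have h2 := hqd (P - P')
        have h3 : (1 : ℝ) ≤ m := by linarith
        nlinarith) (by rw [← intFunctional_add, add_apply, hqw, add_zero, hpw]))
      (hdef _ (by
        rw [← intFunctional_sub, sub_apply]
        have h1 := abs_sub (intFunctional p (P - P')) (intFunctional q (P - P'))
        have h2 := hqd (P - P')
        have h3 : (1 : ℝ) ≤ m := by linarith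
        nlinarith) (by rw [← intFunctional_sub, sub_apply, hqw, sub_zero, hpw]))
    exact absurd (hσS j hj s s') (not_lt.2 hlt.le)
  · push Not at hcase
    have hvn := hv (γ α - γ β)
    rw [← hσα, ← hσβ] at hvn hγαβ
    have hpv : |intFunctional p (σ α - σ β)| ≤ 16 * S := by
      rw [map_sub, abs_le]
      constructor <;> linarith [hcase α β, hcase β α]
    have hqv : 256 * S ≤ m * |intFunctional q (σ α - σ β)| := by
      have h1 : n * (S / K) ≤ n * ‖σ α - σ β‖ := by gcongr
      have h2 : 32 * K * (S / K) ≤ n * (S / K) := by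
        gcongr
        rw [hn']
        have : 0 ≤ 2 * (C : ℝ) * (m + 1) := by positivity
        linarith
      have h3 : 32 * K * (S / K) = 32 * S := by field_simp
      have h4 : n * (S / K) / 2 ≤ n * |intFunctional q (σ α - σ β)| := by linarith
      have h5 : S / K / 2 ≤ |intFunctional q (σ α - σ β)| := by
        refine le_of_mul_le_mul_left ?_ hn0'
        linarith
      calc 256 * S ≤ m * (S / K / 2) := by
            rw [hm']
            have : 512 * (K : ℝ) * (S / K / 2) = 256 * S := by field_simp; ring
            linarith
        _ ≤ _ := by gcongr
    obtain ⟨s₀, s₁, hs⟩ : ∃ s₀ s₁, m * |intFunctional q (σ α - σ β)| =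
        m * intFunctional q (σ s₁) - m * intFunctional q (σ s₀) := by
      rw [map_sub]
      rcases abs_cases (intFunctional q (σ α) - intFunctional q (σ β)) with ⟨h, -⟩ | ⟨h, -⟩
      · exact ⟨β, α, by rw [h]; ring⟩
      · exact ⟨α, β, by rw [h]; ring⟩
    have hmq : ∀ i : ℤ, |(m : ℤ) * i| = m * |i| := fun i => by rw [abs_mul, Nat.abs_cast]
    have hmq' : (m : ℤ) * |q.1| + m * |q.2| ≤ m := by
      rw [← mul_add]
      exact mul_le_of_le_one_right (Int.natCast_nonneg m) hq
    have hmqd : |intFunctional ((m : ℤ) • q) (P - P')| ≤ m * ‖P - P'‖ := by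
      rw [hscale, abs_mul, Nat.abs_cast]
      gcongr
      exact hqd _
    obtain ⟨j, hj, s, s', hlt⟩ := exists_lt_norm_zpow_apply_sub hF hC1 hC hy hx₁ hx₂ hM1 ht
      (p := (m : ℤ) • q) (q := p)
      (by
        simp only [Prod.smul_fst, Prod.smul_snd, smul_eq_mul]
        intro h
        have h1 : (m : ℤ) * (p.1 * q.2 - p.2 * q.1) = 0 := by linear_combination -h
        rcases mul_eq_zero.1 h1 with h2 | h2
        · omega
        · rw [h2, abs_zero] at hdet
          omega)
      (by
        simp only [Prod.smul_fst, Prod.smul_snd, smul_eq_mul, hmq]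
        push_cast [hM]; linarith)
      (by push_cast [hM]; omega)
      (by
        have h1 := abs_add_le (m * q.1) p.1
        have h2 := abs_add_le (m * q.2) p.2
        rw [hmq] at h1 h2
        simp only [Prod.fst_add, Prod.snd_add, Prod.smul_fst, Prod.smul_snd, smul_eq_mul]
        push_cast [hM]; linarith)
      (by
        have h1 := abs_sub (m * q.1) p.1
        have h2 := abs_sub (m * q.2) p.2
        rw [hmq] at h1 h2
        simp only [Prod.fst_sub, Prod.snd_sub, Prod.smul_fst, Prod.smul_snd, smul_eq_mul]
        push_cast [hM]; linarith)
      hD hσc (s₀ := s₀) (s₁ := s₁) (s' := α) (by rw [hscale, hscale]; linarith)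
      (fun s s' => by
        rw [hscale, hscale]
        linarith [hcase s' s])
      (hdef _ (by
        rw [← intFunctional_add, add_apply]
        have h1 := abs_add_le (intFunctional ((m : ℤ) • q) (P - P')) (intFunctional p (P - P'))
        linarith) (by rw [← intFunctional_add, add_apply, hscale, hqw, mul_zero, zero_add, hpw]))
      (hdef _ (by
        rw [← intFunctional_sub, sub_apply]
        have h1 := abs_sub (intFunctional ((m : ℤ) • q) (P - P')) (intFunctional p (P - P'))
        linarith) (by
          rw [← intFunctional_sub, sub_apply, hscale, hqw, mul_zero, zero_sub, abs_neg, hpw]))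
    exact absurd (hσS j hj s s') (not_lt.2 hlt.le)

end

theorem latticePoint_add (k l : ℤ × ℤ) :
    latticePoint (k + l) = latticePoint k + latticePoint l := by
  simp [latticePoint]

theorem exists_norm_apply_sub_le {F : (ℝ × ℝ) ≃ₜ (ℝ × ℝ)}
    (hF : ∀ x k, F (x + latticePoint k) = F x + latticePoint k) :
    ∃ C : ℕ, 1 ≤ C ∧ ∀ x, ‖F x - x‖ ≤ C := by
  have hc : ContinuousOn (fun x => F x - x) (Metric.closedBall 0 1) :=
    (F.continuous.sub continuous_id).continuousOn
  obtain ⟨B, hB⟩ := (isCompact_closedBall (0 : ℝ × ℝ) 1).exists_bound_of_continuousOn hc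
  refine ⟨⌈B⌉₊ + 1, by omega, fun x => ?_⟩
  obtain ⟨k, hk⟩ := exists_latticePoint_near x
  have h := hB (x - latticePoint k) (by
    rw [mem_closedBall_zero_iff, norm_sub_rev]
    exact hk)
  have h2 := hF (x - latticePoint k) k
  rw [sub_add_cancel] at h2
  have h3 : F x - x = F (x - latticePoint k) - (x - latticePoint k) := by rw [h2]; abel
  rw [h3]
  push_cast
  linarith [Nat.le_ceil B]

theorem addRight_zpow_apply (c : ℝ × ℝ) (j : ℤ) (x : ℝ × ℝ) :
    ((Homeomorph.addRight c) ^ j) x = x + j • c := by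
  induction j using Int.induction_on generalizing x with
  | zero => simp
  | succ n ih =>
    rw [zpow_add_apply, zpow_one, ih, Homeomorph.coe_addRight, add_smul, one_smul, add_assoc,
      add_comm c]
  | pred n ih =>
    have h : ((Homeomorph.addRight c) ^ (-1 : ℤ)) x = x + -c := by
      rw [zpow_neg_one]
      rfl
    rw [sub_eq_add_neg, zpow_add_apply, h, ih, add_smul, neg_smul 1 c, one_smul, add_assoc,
      add_comm (-c)]

theorem isExpanding_of_isExpanding_zpow {F : (ℝ × ℝ) ≃ₜ (ℝ × ℝ)}
    (hF : ∀ x k, F (x + latticePoint k) = F x + latticePoint k) {q : ℕ} (k : ℤ × ℤ)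
    {K : ℝ} (h : IsExpanding (Homeomorph.addRight (latticePoint k) * F ^ q) K) :
    IsExpanding F K := by
  obtain ⟨R, hR, J, h⟩ := h
  refine ⟨R, hR, q * J, fun γ hγ α β hαβ hd => ?_⟩
  obtain ⟨j, hj, s, hs, t, ht, hst⟩ := h γ hγ α β hαβ hd
  refine ⟨q * j, ?_, s, hs, t, ht, ?_⟩
  · rw [abs_mul, Nat.abs_cast]
    push_cast
    gcongr
  · have hcomm : Commute (Homeomorph.addRight (latticePoint k)) (F ^ q) :=
      Commute.pow_right (Homeomorph.ext fun x => (hF x k).symm) q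
    rwa [hcomm.mul_zpow, homeomorph_mul_apply, homeomorph_mul_apply, addRight_zpow_apply,
      addRight_zpow_apply, add_sub_add_right_eq_sub, ← zpow_natCast, ← zpow_mul] at hst

theorem isExpanding_of_conj {F : (ℝ × ℝ) ≃ₜ (ℝ × ℝ)} (L : (ℝ × ℝ) ≃L[ℝ] (ℝ × ℝ)) {K K' : ℝ}
    (hK : K * ‖(L : ℝ × ℝ →L[ℝ] ℝ × ℝ)‖ * ‖(L.symm : ℝ × ℝ →L[ℝ] ℝ × ℝ)‖ ≤ K')
    (h : IsExpanding (L.symm.toHomeomorph * F * L.symm.toHomeomorph⁻¹) K') :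
    IsExpanding F K := by
  obtain ⟨R, hR, J, h⟩ := h
  have hL : 0 < ‖(L : ℝ × ℝ →L[ℝ] ℝ × ℝ)‖ := L.norm_pos
  have hL' : 0 < ‖(L.symm : ℝ × ℝ →L[ℝ] ℝ × ℝ)‖ := L.symm.norm_pos
  refine ⟨‖(L : ℝ × ℝ →L[ℝ] ℝ × ℝ)‖ * R, by positivity, J, fun γ hγ α β hαβ hd => ?_⟩
  obtain ⟨j, hj, s, hs, t, ht, hst⟩ := h (fun s => L.symm (γ s)) (L.symm.continuous.comp hγ) α β
    hαβ (by
      rw [← map_sub]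
      have h1 := (L : ℝ × ℝ →L[ℝ] ℝ × ℝ).le_opNorm (L.symm (γ α - γ β))
      rw [ContinuousLinearEquiv.coe_coe, L.apply_symm_apply] at h1
      exact le_of_mul_le_mul_left (hd.trans h1) hL)
  refine ⟨j, hj, s, hs, t, ht, ?_⟩
  have hconj : ∀ x, ((L.symm.toHomeomorph * F * L.symm.toHomeomorph⁻¹) ^ j) (L.symm x) =
      L.symm ((F ^ j) x) := fun x => by
    rw [conj_zpow]
    change L.symm ((F ^ j) (L (L.symm x))) = _
    rw [L.apply_symm_apply]
  rw [hconj, hconj, ← map_sub] at hst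
  have h1 := (L.symm : ℝ × ℝ →L[ℝ] ℝ × ℝ).le_opNorm ((F ^ j) (γ s) - (F ^ j) (γ t))
  rw [ContinuousLinearEquiv.coe_coe] at h1
  refine le_of_mul_le_mul_left ?_ hL'
  nlinarith

theorem isExpanding_of_noncollinear {F : (ℝ × ℝ) ≃ₜ (ℝ × ℝ)}
    (hF : ∀ x k, F (x + latticePoint k) = F x + latticePoint k) {x₁ x₂ x₃ : ℝ × ℝ} {q : ℕ}
    {w₁ w₂ w₃ : ℤ × ℤ} (h₁ : (F ^ q) x₁ = x₁ + latticePoint w₁)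
    (h₂ : (F ^ q) x₂ = x₂ + latticePoint w₂) (h₃ : (F ^ q) x₃ = x₃ + latticePoint w₃)
    (hdet : (w₂ - w₁).1 * (w₃ - w₁).2 - (w₂ - w₁).2 * (w₃ - w₁).1 ≠ 0) (K : ℝ) :
    IsExpanding F K := by
  obtain ⟨u, hu⟩ : ∃ u, u = w₂ - w₁ := ⟨_, rfl⟩
  obtain ⟨v, hv⟩ : ∃ v, v = w₃ - w₁ := ⟨_, rfl⟩
  rw [← hu, ← hv] at hdet
  have hdet' : u.1 * v.2 - v.1 * u.2 ≠ 0 := by rwa [mul_comm v.1]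
  set L₀ := (intFunctional (u.1, v.1)).prod (intFunctional (u.2, v.2)) with hL₀
  have hinj : Function.Injective L₀ := (injective_iff_map_eq_zero L₀).2 fun x hx =>
    eq_zero_of_intFunctional_eq_zero hdet' x (congrArg Prod.fst hx) (congrArg Prod.snd hx)
  have hsurj : Function.Surjective L₀ := fun z =>
    (exists_intFunctional_eq hdet' z.1 z.2).imp fun x hx => Prod.ext hx.1 hx.2
  set L := ContinuousLinearEquiv.ofBijective L₀ (LinearMap.ker_eq_bot.2 hinj)
    (LinearMap.range_eq_top.2 hsurj) with hL
  have hLk : ∀ k, L (latticePoint k) =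
      latticePoint (u.1 * k.1 + v.1 * k.2, u.2 * k.1 + v.2 * k.2) := fun k => by
    rw [hL, ContinuousLinearEquiv.coeFn_ofBijective]
    simp [hL₀, intFunctional_apply, latticePoint]
  have hLs : ∀ k, L.symm (latticePoint (u.1 * k.1 + v.1 * k.2, u.2 * k.1 + v.2 * k.2)) =
      latticePoint k := fun k => by rw [← hLk, L.symm_apply_apply]
  obtain ⟨K', hK'⟩ := exists_nat_ge
    (K * ‖(L : ℝ × ℝ →L[ℝ] ℝ × ℝ)‖ * ‖(L.symm : ℝ × ℝ →L[ℝ] ℝ × ℝ)‖)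
  refine isExpanding_of_isExpanding_zpow hF (q := q) (-w₁) (isExpanding_of_conj L
    (K' := ((K' + 1 : ℕ) : ℝ)) (hK'.trans (by push_cast; linarith)) ?_)
  set G := L.symm.toHomeomorph * (Homeomorph.addRight (latticePoint (-w₁)) * F ^ q) *
    L.symm.toHomeomorph⁻¹ with hG
  have hGx : ∀ x, G x = L.symm ((F ^ q) (L x) + latticePoint (-w₁)) := fun _ => rfl
  have hGL : ∀ x, G (L.symm x) = L.symm ((F ^ q) x + latticePoint (-w₁)) := fun x => by
    rw [hGx, L.apply_symm_apply]
  have hGper : ∀ x k, G (x + latticePoint k) = G x + latticePoint k := fun x k => by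
    have h := zpow_apply_add_latticePoint hF q
    simp only [zpow_natCast] at h
    rw [hGx, map_add L, hLk, h, add_right_comm, map_add L.symm, hLs, hGx]
  obtain ⟨C, hC1, hC⟩ := exists_norm_apply_sub_le hGper
  refine isExpanding_of_fixed hGper hC1 hC (y := L.symm x₁) (x₁ := L.symm x₂) (x₂ := L.symm x₃)
    ?_ ?_ ?_ (by omega)
  · rw [hGL, h₁, add_assoc, ← latticePoint_add, add_neg_cancel]
    simp [latticePoint]
  · rw [hGL, h₂, add_assoc, ← latticePoint_add, ← sub_eq_add_neg, ← hu, map_add]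
    simpa using hLs (1, 0)
  · rw [hGL, h₃, add_assoc, ← latticePoint_add, ← sub_eq_add_neg, ← hv, map_add]
    simpa using hLs (0, 1)

theorem exists_first_hitting {φ : ℝ → ℝ} (hφ : Continuous φ) {a b R : ℝ} (hab : a ≤ b)
    (ha : φ a ≤ R) (hb : R ≤ φ b) : ∃ c ∈ Set.Icc a b, φ c = R ∧ ∀ s ∈ Set.Icc a c, φ s ≤ R := by
  have hK : IsCompact (Set.Icc a b ∩ φ ⁻¹' {R}) :=
    isCompact_Icc.inter_right (isClosed_singleton.preimage hφ)
  obtain ⟨c₀, hc₀, hc₀R⟩ := intermediate_value_Icc hab hφ.continuousOn ⟨ha, hb⟩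
  obtain ⟨c, ⟨hc, hcR⟩, hmin⟩ := hK.exists_isLeast ⟨c₀, hc₀, hc₀R⟩
  refine ⟨c, hc, hcR, fun s hs => ?_⟩
  by_contra! hcon
  obtain ⟨r, hr, hrR⟩ := intermediate_value_Icc hs.1 hφ.continuousOn ⟨ha, hcon.le⟩
  have h1 : c ≤ r := hmin ⟨⟨hr.1, hr.2.trans (hs.2.trans hc.2)⟩, hrR⟩
  obtain rfl : r = s := le_antisymm hr.2 (hs.2.trans h1)
  exact hcon.ne' hrR

theorem exists_last_hitting {φ : ℝ → ℝ} (hφ : Continuous φ) {a b R : ℝ} (hab : a ≤ b)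
    (ha : R ≤ φ a) (hb : φ b ≤ R) : ∃ c ∈ Set.Icc a b, φ c = R ∧ ∀ s ∈ Set.Icc c b, φ s ≤ R := by
  obtain ⟨c, hc, hcR, h⟩ := exists_first_hitting (φ := fun s => φ (-s)) (by fun_prop)
    (neg_le_neg hab) (by simpa using hb) (by simpa using ha)
  refine ⟨-c, ⟨by linarith [hc.2], by linarith [hc.1]⟩, hcR, fun s hs => ?_⟩
  simpa using h (-s) ⟨by linarith [hs.2], by linarith [hs.1]⟩

/-- A path that becomes four times as long as `R` contains two disjoint subpaths that are as long
as `R`, and at distance at least `R`. -/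
theorem exists_separated_subpaths {δ : ℝ → ℝ × ℝ} (hδ : Continuous δ) {R a b : ℝ} (hR : 0 < R)
    (hab : a ≤ b) (h : 4 * R ≤ ‖δ a - δ b‖) :
    ∃ a' ∈ Set.Icc a b, ∃ b' ∈ Set.Icc a b, R ≤ ‖δ a - δ a'‖ ∧ R ≤ ‖δ b' - δ b‖ ∧
      ∀ s ∈ Set.Icc a a', ∀ t ∈ Set.Icc b' b, R ≤ ‖δ s - δ t‖ := by
  obtain ⟨a', ha', haR, hA⟩ := exists_first_hitting (φ := fun s => ‖δ a - δ s‖) (by fun_prop)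
    (R := R) hab (by simpa using hR.le) (by linarith)
  obtain ⟨b', hb', hbR, hB⟩ := exists_last_hitting (φ := fun s => ‖δ s - δ b‖) (by fun_prop)
    (R := R) hab (by linarith) (by simpa using hR.le)
  refine ⟨a', ha', b', hb', haR.ge, hbR.ge, fun s hs t ht => ?_⟩
  have h1 := hA s hs
  have h2 := hB t ht
  have h3 : δ a - δ b = (δ a - δ s) + (δ s - δ t) + (δ t - δ b) := by abel
  have h4 := norm_add₃_le (a := δ a - δ s) (b := δ s - δ t) (c := δ t - δ b)
  rw [← h3] at h4
  linarith

theorem exists_separated_finset {F : (ℝ × ℝ) ≃ₜ (ℝ × ℝ)} {R : ℝ} (hR : 0 < R) {J : ℕ}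
    (hF : ∀ γ : ℝ → ℝ × ℝ, Continuous γ → ∀ α β, α ≤ β →
      R ≤ ‖γ α - γ β‖ → ∃ j : ℤ, |j| ≤ J ∧ ∃ s ∈ Set.Icc α β, ∃ t ∈ Set.Icc α β,
        4 * R ≤ ‖(F ^ j) (γ s) - (F ^ j) (γ t)‖) (m : ℕ) {γ : ℝ → ℝ × ℝ} (hγ : Continuous γ)
    {α β : ℝ} (hαβ : α ≤ β) (h : R ≤ ‖γ α - γ β‖) :
    ∃ S : Finset ℝ, (↑S ⊆ Set.Icc α β) ∧ S.card = 2 ^ m ∧ ∀ s ∈ S, ∀ t ∈ S, s ≠ t →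
      ∃ j : ℤ, |j| ≤ m * J ∧ R ≤ ‖(F ^ j) (γ s) - (F ^ j) (γ t)‖ := by
  induction m generalizing γ α β with
  | zero =>
    refine ⟨{α}, by simpa using hαβ, by simp, fun s hs t ht hst => ?_⟩
    rw [Finset.mem_singleton] at hs ht
    exact absurd (hs.trans ht.symm) hst
  | succ m ih =>
    obtain ⟨j, hj, s, hs, t, ht, hst⟩ := hF γ hγ α β hαβ h
    wlog hle : s ≤ t generalizing s t
    · exact this t ht s hs (by rwa [norm_sub_rev]) (le_of_not_ge hle)
    obtain ⟨s', hs', t', ht', h1, h2, hsep⟩ :=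
      exists_separated_subpaths (δ := fun s => (F ^ j) (γ s))
        ((F ^ j).continuous.comp hγ) hR hle hst
    obtain ⟨S, hS, hSc, hSsep⟩ := ih (γ := fun s => (F ^ j) (γ s)) ((F ^ j).continuous.comp hγ)
      hs'.1 h1
    obtain ⟨T, hT, hTc, hTsep⟩ := ih (γ := fun s => (F ^ j) (γ s)) ((F ^ j).continuous.comp hγ)
      ht'.2 h2
    have hdisj : Disjoint S T := Finset.disjoint_left.2 fun r hr hr' => by
      have := hsep r (hS hr) r (hT hr')
      rw [sub_self, norm_zero] at this
      linarith
    have hadd : ∀ i : ℤ, |i| ≤ m * J → |i + j| ≤ ((m + 1 : ℕ) : ℤ) * J := fun i hi => by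
      push_cast
      linarith [abs_add_le i j]
    have hm : (0 : ℤ) ≤ m * J := by positivity
    refine ⟨S ∪ T, ?_, ?_, ?_⟩
    · rw [Finset.coe_union, Set.union_subset_iff]
      exact ⟨hS.trans (Set.Icc_subset_Icc hs.1 (hs'.2.trans ht.2)),
        hT.trans (Set.Icc_subset_Icc (hs.1.trans ht'.1) ht.2)⟩
    · rw [Finset.card_union_of_disjoint hdisj, hSc, hTc]
      ring
    · intro x hx y hy hxy
      rw [Finset.mem_union] at hx hy
      rcases hx with hx | hx <;> rcases hy with hy | hy
      · obtain ⟨i, hi, hxy⟩ := hSsep x hx y hy hxy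
        exact ⟨i + j, hadd i hi, by rwa [zpow_add_apply, zpow_add_apply]⟩
      · exact ⟨0 + j, hadd 0 (by simpa using hm), by rw [zero_add]; exact hsep x (hS hx) y (hT hy)⟩
      · refine ⟨0 + j, hadd 0 (by simpa using hm), ?_⟩
        rw [zero_add, norm_sub_rev]
        exact hsep y (hS hy) x (hT hx)
      · obtain ⟨i, hi, hxy⟩ := hTsep x hx y hy hxy
        exact ⟨i + j, hadd i hi, by rwa [zpow_add_apply, zpow_add_apply]⟩

theorem exists_norm_apply_sub_lt {F : (ℝ × ℝ) ≃ₜ (ℝ × ℝ)}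
    (hF : ∀ x k, F (x + latticePoint k) = F x + latticePoint k) {ε : ℝ} (hε : 0 < ε) :
    ∃ δ > 0, ∀ x y, ‖x - y‖ < δ → ‖F x - F y‖ < ε := by
  have hu := (isCompact_closedBall (0 : ℝ × ℝ) 2).uniformContinuousOn_of_continuous
    F.continuous.continuousOn
  rw [Metric.uniformContinuousOn_iff] at hu
  obtain ⟨δ, hδ, h⟩ := hu ε hε
  refine ⟨min δ 1, by positivity, fun x y hxy => ?_⟩
  obtain ⟨k, hk⟩ := exists_latticePoint_near x
  have hx : ‖x - latticePoint k‖ ≤ 1 := by rwa [norm_sub_rev]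
  have hy : ‖y - latticePoint k‖ ≤ 2 := by
    have h1 := norm_sub_le (x - latticePoint k) (x - y)
    rw [show x - latticePoint k - (x - y) = y - latticePoint k by abel] at h1
    linarith [hxy.trans_le (min_le_right _ _)]
  have h1 := h (x - latticePoint k) (by rw [mem_closedBall_zero_iff]; linarith)
    (y - latticePoint k) (by rwa [mem_closedBall_zero_iff])
    (by rw [dist_eq_norm, sub_sub_sub_cancel_right]; exact hxy.trans_le (min_le_left _ _))
  have h2 := hF (x - latticePoint k) k
  have h3 := hF (y - latticePoint k) k
  rw [sub_add_cancel] at h2 h3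
  rwa [h2, h3, add_sub_add_right_eq_sub, ← dist_eq_norm]

theorem latticePoint_eq_of_norm_sub_lt {k l : ℤ × ℤ} (h : ‖latticePoint k - latticePoint l‖ < 1) :
    k = l := by
  have h1 := (norm_fst_le _).trans_lt h
  have h2 := (norm_snd_le _).trans_lt h
  simp only [latticePoint, Prod.fst_sub, Prod.snd_sub, Real.norm_eq_abs] at h1 h2
  norm_cast at h1 h2
  rw [Int.abs_lt_one_iff, sub_eq_zero] at h1 h2
  exact Prod.ext h1 h2

theorem iterate_apply_add_latticePoint {F : (ℝ × ℝ) ≃ₜ (ℝ × ℝ)}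
    (hF : ∀ x k, F (x + latticePoint k) = F x + latticePoint k) (n : ℕ) (x : ℝ × ℝ) (k : ℤ × ℤ) :
    F^[n] (x + latticePoint k) = F^[n] x + latticePoint k := by
  induction n with
  | zero => rfl
  | succ n ih => rw [Function.iterate_succ_apply', ih, hF, Function.iterate_succ_apply']

theorem exists_forall_norm_iterate_sub_lt {F : (ℝ × ℝ) ≃ₜ (ℝ × ℝ)}
    (hF : ∀ x k, F (x + latticePoint k) = F x + latticePoint k) {η : ℝ} (hη : η ≤ 1 / 4)
    (hFη : ∀ x y, ‖x - y‖ < η → ‖F x - F y‖ < 1 / 4) {n : ℕ} {x y : ℝ × ℝ}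
    (h : ∀ i < n, ∃ k, ‖F^[i] x - F^[i] y - latticePoint k‖ < η) :
    ∃ k, ∀ i < n, ‖F^[i] x - F^[i] y - latticePoint k‖ < η := by
  rcases n.eq_zero_or_pos with rfl | hn
  · exact ⟨0, by simp⟩
  obtain ⟨k, hk⟩ := h 0 hn
  refine ⟨k, fun i => ?_⟩
  induction i with
  | zero => exact fun _ => hk
  | succ i ih =>
    intro hi
    obtain ⟨l, hl⟩ := h (i + 1) hi
    have h1 := hFη (F^[i] x) (F^[i] y + latticePoint k)
      (by rw [← sub_sub]; exact ih (by omega))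
    rw [hF, ← sub_sub, ← Function.iterate_succ_apply' (⇑F),
      ← Function.iterate_succ_apply' (⇑F)] at h1
    obtain rfl : k = l := by
      refine latticePoint_eq_of_norm_sub_lt ?_
      have h2 := norm_sub_le (F^[i + 1] x - F^[i + 1] y - latticePoint l)
        (F^[i + 1] x - F^[i + 1] y - latticePoint k)
      rw [sub_sub_sub_cancel_left] at h2
      linarith
    exact hl

theorem card_le_of_norm_iterate_sub_lt {F : (ℝ × ℝ) ≃ₜ (ℝ × ℝ)} {η R : ℝ}
    (hη : η ≤ 1) (hR : 2 * η ≤ R)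
    {B n i₀ : ℕ} (hi₀ : i₀ < n) {A : Finset (ℝ × ℝ)}
    (hsep : ∀ x ∈ A, ∀ y ∈ A, x ≠ y → ∃ i < n, R ≤ ‖F^[i] x - F^[i] y‖)
    (hbdd : ∀ x ∈ A, ∀ y ∈ A, ‖F^[i₀] x - F^[i₀] y‖ ≤ B)
    (hlat : ∀ x ∈ A, ∀ y ∈ A, ∃ k, ∀ i < n, ‖F^[i] x - F^[i] y - latticePoint k‖ < η) :
    A.card ≤ (2 * B + 3) ^ 2 := by
  rcases A.eq_empty_or_nonempty with rfl | ⟨y, hy⟩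
  · simp
  choose! k hk using fun x hx => hlat x hx y hy
  have hmaps : ∀ x ∈ A,
      k x ∈ Finset.Icc (-(B + 1 : ℤ)) (B + 1) ×ˢ Finset.Icc (-(B + 1 : ℤ)) (B + 1) := by
    intro x hx
    have h1 := norm_sub_le (F^[i₀] x - F^[i₀] y)
      (F^[i₀] x - F^[i₀] y - latticePoint (k x))
    rw [sub_sub_cancel] at h1
    have h2 : ‖latticePoint (k x)‖ ≤ B + 1 := by linarith [hk x hx i₀ hi₀, hbdd x hx y hy]
    have h3 := (norm_fst_le _).trans h2
    have h4 := (norm_snd_le _).trans h2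
    simp only [latticePoint, Real.norm_eq_abs] at h3 h4
    norm_cast at h3 h4
    rw [abs_le] at h3 h4
    simp only [Finset.mem_product, Finset.mem_Icc]
    push_cast at h3 h4
    exact ⟨h3, h4⟩
  have hinj : Set.InjOn k A := by
    intro x hx z hz hxz
    by_contra hne
    obtain ⟨i, hi, h⟩ := hsep x hx z hz hne
    have h1 := hk x hx i hi
    have h2 := hk z hz i hi
    have h3 := norm_sub_le (F^[i] x - F^[i] y - latticePoint (k x))
      (F^[i] z - F^[i] y - latticePoint (k z))
    rw [hxz, sub_sub_sub_cancel_right, sub_sub_sub_cancel_right] at h3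
    rw [hxz] at h1
    linarith
  refine (Finset.card_le_card_of_injOn k hmaps hinj).trans_eq ?_
  rw [Finset.card_product, Int.card_Icc, sq]
  congr 1 <;> omega

theorem exists_norm_sub_sub_latticePoint_lt {ε : ℝ} {x y : ℝ × ℝ}
    (h : dist ((x.1 : AddCircle (1 : ℝ)), (x.2 : AddCircle (1 : ℝ)))
      ((y.1 : AddCircle (1 : ℝ)), (y.2 : AddCircle (1 : ℝ))) < ε) :
    ∃ k, ‖x - y - latticePoint k‖ < ε := by
  rw [Prod.dist_eq, max_lt_iff, dist_eq_norm, dist_eq_norm, ← AddCircle.coe_sub,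
    ← AddCircle.coe_sub, UnitAddCircle.norm_eq, UnitAddCircle.norm_eq] at h
  refine ⟨(round (x.1 - y.1), round (x.2 - y.2)), ?_⟩
  rw [Prod.norm_def, max_lt_iff]
  exact h

theorem iterate_lift
    {f : (AddCircle (1 : ℝ) × AddCircle (1 : ℝ)) → (AddCircle (1 : ℝ) × AddCircle (1 : ℝ))}
    {F : ℝ × ℝ → ℝ × ℝ}
    (hF : ∀ x : ℝ × ℝ,
      f ((↑x.1 : AddCircle (1 : ℝ)), (↑x.2 : AddCircle (1 : ℝ)))
        = ((↑(F x).1 : AddCircle (1 : ℝ)), (↑(F x).2 : AddCircle (1 : ℝ)))) (n : ℕ) (x : ℝ × ℝ) :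
    f^[n] ((↑x.1 : AddCircle (1 : ℝ)), (↑x.2 : AddCircle (1 : ℝ)))
        = ((↑(F^[n] x).1 : AddCircle (1 : ℝ)), (↑(F^[n] x).2 : AddCircle (1 : ℝ))) := by
  induction n generalizing x with
  | zero => rfl
  | succ n ih => rw [Function.iterate_succ_apply, hF, ih, Function.iterate_succ_apply]

theorem zpow_natCast_apply (F : (ℝ × ℝ) ≃ₜ (ℝ × ℝ)) (n : ℕ) (x : ℝ × ℝ) :
    (F ^ (n : ℤ)) x = F^[n] x := by
  induction n generalizing x with
  | zero => rfl
  | succ n ih =>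
    rw [Nat.cast_succ, zpow_add_apply, ih, zpow_one, Function.iterate_succ_apply]

theorem exists_two_pow_le_card_of_isDynCoverOf
    {f : (AddCircle (1 : ℝ) × AddCircle (1 : ℝ)) → (AddCircle (1 : ℝ) × AddCircle (1 : ℝ))}
    {F : (ℝ × ℝ) ≃ₜ (ℝ × ℝ)} (hF : ∀ x k, F (x + latticePoint k) = F x + latticePoint k)
    (hf : ∀ x : ℝ × ℝ,
      f ((↑x.1 : AddCircle (1 : ℝ)), (↑x.2 : AddCircle (1 : ℝ)))
        = ((↑(F x).1 : AddCircle (1 : ℝ)), (↑(F x).2 : AddCircle (1 : ℝ))))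
    (hexp : IsExpanding F 4) :
    ∃ U ∈ uniformity (AddCircle (1 : ℝ) × AddCircle (1 : ℝ)), ∃ D J : ℕ, ∀ m : ℕ,
      ∀ s : Finset (AddCircle (1 : ℝ) × AddCircle (1 : ℝ)),
        Dynamics.IsDynCoverOf f Set.univ U (2 * (m * J) + 1) s → 2 ^ m ≤ D * s.card := by
  classical
  obtain ⟨R, hR, J, hRJ⟩ := hexp
  obtain ⟨δ, hδ, hFδ⟩ := exists_norm_apply_sub_lt hF (ε := 1 / 4) (by norm_num)
  obtain ⟨η, hη, hη1, hηδ, hηR⟩ : ∃ η > 0, η ≤ 1 / 4 ∧ η ≤ δ ∧ 2 * η ≤ R :=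
    ⟨min (1 / 4) (min δ (R / 2)), by positivity, min_le_left _ _,
      (min_le_right _ _).trans (min_le_left _ _),
      by linarith [(min_le_right (1 / 4) (min δ (R / 2))).trans (min_le_right _ _)]⟩
  obtain ⟨B, hB⟩ := exists_nat_ge R
  refine ⟨_, Metric.dist_mem_uniformity (half_pos hη), (2 * B + 3) ^ 2, J, fun m s hs => ?_⟩
  obtain ⟨S, hS, hSc, hsep⟩ := exists_separated_finset hR hRJ m (γ := fun s => (s, 0))
    (by fun_prop) hR.le (by simp [Prod.norm_def, abs_of_pos hR])
  set N := m * J with hN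
  have hinj : Function.Injective fun r : ℝ => (F ^ (-(N : ℤ))) (r, 0) := fun r t hrt => by
    simpa using (F ^ (-(N : ℤ))).injective hrt
  have hiter : ∀ (i : ℕ) (r : ℝ), F^[i] ((F ^ (-(N : ℤ))) (r, 0)) = (F ^ ((i : ℤ) - N)) (r, 0) :=
    fun i r => by rw [← zpow_natCast_apply, ← zpow_add_apply, sub_eq_add_neg]
  set T := S.image fun r : ℝ => (F ^ (-(N : ℤ))) (r, 0) with hT
  have hTc : T.card = 2 ^ m := by rw [hT, Finset.card_image_of_injective _ hinj, hSc]
  choose c hc hxc using fun x : ℝ × ℝ =>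
    hs (Set.mem_univ ((x.1 : AddCircle (1 : ℝ)), (x.2 : AddCircle (1 : ℝ))))
  rw [← hTc]
  refine Finset.card_le_mul_card_image_of_maps_to (f := c) (fun x _ => hc x) _ fun b hb => ?_
  refine card_le_of_norm_iterate_sub_lt (F := F) (η := η) (by linarith) hηR
    (n := 2 * N + 1) (i₀ := N) (by omega) ?_ ?_ ?_
  · simp only [Finset.mem_filter, hT, Finset.mem_image]
    rintro _ ⟨⟨r, hr, rfl⟩, -⟩ _ ⟨⟨t, ht, rfl⟩, -⟩ hne
    obtain ⟨j, hj, h⟩ := hsep r hr t ht fun h => hne (by rw [h])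
    have hj' : |j| ≤ N := by rw [hN]; exact_mod_cast hj
    rw [abs_le] at hj'
    refine ⟨(j + N).toNat, by omega, ?_⟩
    rw [hiter, hiter, Int.toNat_of_nonneg (by omega), add_sub_cancel_right]
    exact h
  · simp only [Finset.mem_filter, hT, Finset.mem_image]
    rintro _ ⟨⟨r, hr, rfl⟩, -⟩ _ ⟨⟨t, ht, rfl⟩, -⟩
    rw [hiter, hiter, sub_self, zpow_zero]
    have h1 := hS hr
    have h2 := hS ht
    have h3 : |r - t| ≤ R := by rw [abs_le]; constructor <;> linarith [h1.1, h1.2, h2.1, h2.2]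
    refine le_trans ?_ hB
    simpa [Prod.norm_def, hR.le] using h3
  · intro x hx y hy
    rw [Finset.mem_filter] at hx hy
    refine exists_forall_norm_iterate_sub_lt hF hη1 (fun u v h => hFδ u v (h.trans_le hηδ))
      fun i hi => ?_
    refine exists_norm_sub_sub_latticePoint_lt ?_
    have h1 := Dynamics.mem_dynEntourage.1 (hxc x) i hi
    have h2 := Dynamics.mem_dynEntourage.1 (hxc y) i hi
    simp only [Set.mem_ofPred_eq, iterate_lift hf, hx.2] at h1
    simp only [Set.mem_ofPred_eq, iterate_lift hf, hy.2] at h2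
    linarith [dist_triangle_right
      ((↑(F^[i] x).1 : AddCircle (1 : ℝ)), (↑(F^[i] x).2 : AddCircle (1 : ℝ)))
      ((↑(F^[i] y).1 : AddCircle (1 : ℝ)), (↑(F^[i] y).2 : AddCircle (1 : ℝ))) (f^[i] b)]

theorem coverEntropy_pos_of_two_pow_le_card {X : Type*} [UniformSpace X] {T : X → X}
    {U : SetRel X X}
    (hU : U ∈ uniformity X) {D J : ℕ}
    (h : ∀ m : ℕ, ∀ s : Finset X, Dynamics.IsDynCoverOf T Set.univ U (2 * (m * J) + 1) s →
      2 ^ m ≤ D * s.card) : 0 < Dynamics.coverEntropy T Set.univ := by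
  set a : ℝ := Real.log 2 / (5 * (J + 1)) with ha
  have ha0 : (0 : EReal) < a := by
    rw [EReal.coe_pos]
    have := Real.log_pos one_lt_two
    positivity
  refine ha0.trans_le (le_trans ?_ (Dynamics.coverEntropyEntourage_le_coverEntropy T Set.univ hU))
  refine Frequently.le_expGrowthSup (frequently_atTop.2 fun n => ?_)
  set m := n + D + 1 with hm
  refine ⟨2 * (2 * m * (J + 1)) + 1, by nlinarith, ?_⟩
  have hcard : ∀ s : Finset X, Dynamics.IsDynCoverOf T Set.univ U (2 * (2 * m * (J + 1)) + 1) s →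
      2 ^ m ≤ s.card := by
    intro s hs
    have h1 := h (2 * m) s (hs.of_le (by gcongr; omega))
    have hD : D ≤ 2 ^ m := Nat.lt_two_pow_self.le.trans (Nat.pow_le_pow_right two_pos (by omega))
    have hpos : 0 < D := Nat.pos_of_ne_zero fun hD => by simp [hD] at h1
    rw [two_mul, pow_add] at h1
    exact Nat.le_of_mul_le_mul_left ((Nat.mul_le_mul_right _ hD).trans h1) hpos
  have hmin : ((2 ^ m : ℕ) : ℕ∞) ≤ Dynamics.coverMincard T Set.univ U (2 * (2 * m * (J + 1)) + 1) :=
    le_iInf₂ fun s hs => by exact_mod_cast hcard s hs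
  have hexp : Real.exp (a * (2 * (2 * m * (J + 1)) + 1 : ℕ)) ≤ (2 ^ m : ℕ) := by
    have h1 : a * (2 * (2 * m * (J + 1)) + 1 : ℕ) ≤ m * Real.log 2 := by
      have h2 : ((2 * (2 * m * (J + 1)) + 1 : ℕ) : ℝ) ≤ 5 * (J + 1) * m := by
        have : 2 * (2 * m * (J + 1)) + 1 ≤ 5 * (J + 1) * m := by nlinarith
        exact_mod_cast this
      have h3 := Real.log_pos one_lt_two
      calc _ ≤ a * (5 * (J + 1) * m) := by gcongr
        _ = m * Real.log 2 := by rw [ha]; field_simp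
    refine (Real.exp_le_exp.2 h1).trans_eq ?_
    rw [Real.exp_nat_mul, Real.exp_log two_pos]
    push_cast
    rfl
  refine le_trans ?_ (ENat.toENNReal_le.2 hmin)
  rw [← EReal.coe_coe_eq_natCast, ← EReal.coe_mul, EReal.exp_coe]
  exact (ENNReal.ofReal_le_ofReal hexp).trans_eq (by simp)

theorem homeomorph_npow_apply (F : (ℝ × ℝ) ≃ₜ (ℝ × ℝ)) (n : ℕ) (x : ℝ × ℝ) :
    (F ^ n) x = F^[n] x := by
  rw [← zpow_natCast_apply, zpow_natCast]

theorem npow_mul_apply_of_iterate {F : (ℝ × ℝ) ≃ₜ (ℝ × ℝ)}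
    (hF : ∀ x k, F (x + latticePoint k) = F x + latticePoint k) {q : ℕ} {x : ℝ × ℝ} {p : ℤ × ℤ}
    (h : F^[q] x = x + latticePoint p) (n : ℕ) :
    (F ^ (q * n)) x = x + latticePoint ((n : ℤ) • p) := by
  rw [homeomorph_npow_apply, Function.iterate_mul]
  induction n with
  | zero => simp [latticePoint]
  | succ n ih =>
    rw [Function.iterate_succ_apply', ih, iterate_apply_add_latticePoint hF, h, add_assoc,
      ← latticePoint_add]
    congr 2
    push_cast
    rw [add_smul, one_smul, add_comm]

/-- (Llibre–MacKay) Let `f` be a homeomorphism of the torus `𝕋² = ℝ²/ℤ²` isotopic to the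
identity, with a lift `F : ℝ² → ℝ²` commuting with all integer translations. If `f` has
three periodic orbits whose rotation vectors `pᵢ/qᵢ` are noncollinear (equivalently,
`v₂ - v₁` and `v₃ - v₁` are linearly independent), then the topological entropy of `f`
is positive. -/
theorem llibre_mackay_positive_entropy
    (f : (AddCircle (1 : ℝ) × AddCircle (1 : ℝ)) ≃ₜ (AddCircle (1 : ℝ) × AddCircle (1 : ℝ)))
    (F : (ℝ × ℝ) ≃ₜ (ℝ × ℝ))
    (hF_per : ∀ (x : ℝ × ℝ) (m : ℤ × ℤ),
      F (x + ((m.1 : ℝ), (m.2 : ℝ))) = F x + ((m.1 : ℝ), (m.2 : ℝ)))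
    (hF_lift : ∀ x : ℝ × ℝ,
      f ((↑x.1 : AddCircle (1 : ℝ)), (↑x.2 : AddCircle (1 : ℝ)))
        = ((↑(F x).1 : AddCircle (1 : ℝ)), (↑(F x).2 : AddCircle (1 : ℝ))))
    (x₁ x₂ x₃ : ℝ × ℝ) (q₁ q₂ q₃ : ℕ) (hq₁ : 1 ≤ q₁) (hq₂ : 1 ≤ q₂) (hq₃ : 1 ≤ q₃)
    (p₁ p₂ p₃ : ℤ × ℤ)
    (h₁ : (⇑F)^[q₁] x₁ = x₁ + ((p₁.1 : ℝ), (p₁.2 : ℝ)))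
    (h₂ : (⇑F)^[q₂] x₂ = x₂ + ((p₂.1 : ℝ), (p₂.2 : ℝ)))
    (h₃ : (⇑F)^[q₃] x₃ = x₃ + ((p₃.1 : ℝ), (p₃.2 : ℝ)))
    (v₁ v₂ v₃ : ℝ × ℝ)
    (hv₁ : v₁ = ((p₁.1 : ℝ) / (q₁ : ℝ), (p₁.2 : ℝ) / (q₁ : ℝ)))
    (hv₂ : v₂ = ((p₂.1 : ℝ) / (q₂ : ℝ), (p₂.2 : ℝ) / (q₂ : ℝ)))
    (hv₃ : v₃ = ((p₃.1 : ℝ) / (q₃ : ℝ), (p₃.2 : ℝ) / (q₃ : ℝ)))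
    (hnoncol : LinearIndependent ℝ ![v₂ - v₁, v₃ - v₁]) :
    0 < Dynamics.coverEntropy (⇑f) Set.univ := by
  have hF : ∀ x k, F (x + latticePoint k) = F x + latticePoint k := hF_per
  have e₁ := npow_mul_apply_of_iterate hF h₁ (q₂ * q₃)
  have e₂ := npow_mul_apply_of_iterate hF h₂ (q₁ * q₃)
  have e₃ := npow_mul_apply_of_iterate hF h₃ (q₁ * q₂)
  rw [← mul_assoc] at e₁
  rw [mul_left_comm, ← mul_assoc] at e₂
  rw [mul_comm] at e₃
  have hdet : (v₂ - v₁).1 * (v₃ - v₁).2 - (v₂ - v₁).2 * (v₃ - v₁).1 ≠ 0 := by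
    intro h0
    rw [LinearIndependent.pair_iff] at hnoncol
    have h1 := hnoncol (v₃ - v₁).2 (-(v₂ - v₁).2) (by
      ext
      · simp only [Prod.fst_add, Prod.smul_fst, smul_eq_mul, Prod.fst_zero]; linarith
      · simp only [Prod.snd_add, Prod.smul_snd, smul_eq_mul, Prod.snd_zero]; ring)
    have h2 := hnoncol (v₃ - v₁).1 (-(v₂ - v₁).1) (by
      ext
      · simp only [Prod.fst_add, Prod.smul_fst, smul_eq_mul, Prod.fst_zero]; ring
      · simp only [Prod.snd_add, Prod.smul_snd, smul_eq_mul, Prod.snd_zero]; linarith)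
    have h3 : v₃ - v₁ = 0 := Prod.ext h2.1 h1.1
    have := hnoncol 0 1 (by simp [h3])
    exact one_ne_zero this.2
  have hq₁' : (q₁ : ℝ) ≠ 0 := by positivity
  have hq₂' : (q₂ : ℝ) ≠ 0 := by positivity
  have hq₃' : (q₃ : ℝ) ≠ 0 := by positivity
  obtain ⟨U, hU, D, J, h⟩ := exists_two_pow_le_card_of_isDynCoverOf hF hF_lift
    (isExpanding_of_noncollinear hF e₁ e₂ e₃ (fun h0 => hdet (by
      have h0' := congrArg (Int.cast : ℤ → ℝ) h0
      simp only [Prod.fst_sub, Prod.snd_sub, Prod.smul_fst, Prod.smul_snd, smul_eq_mul] at h0'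
      push_cast at h0'
      simp only [hv₁, hv₂, hv₃, Prod.fst_sub, Prod.snd_sub]
      field_simp
      refine mul_left_cancel₀ (mul_ne_zero hq₂' hq₃') ?_
      linear_combination h0')) 4)
  exact coverEntropy_pos_of_two_pow_le_card hU h
end

section
/- Every homeomorphism f of the circle 𝕋 = ℝ/ℤ has zero topological entropy: h_top(f) = 0. -/
open Set Filter Topology

theorem ExpGrowth.expGrowthSup_natCast :
    ExpGrowth.expGrowthSup (fun n : ℕ ↦ (n : ENNReal)) = 0 := by
  have h : Tendsto (fun n : ℕ ↦ ((Real.log n / n : ℝ) : EReal)) atTop (𝓝 0) := by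
    have := Real.isLittleO_log_id_atTop.tendsto_div_nhds_zero.comp
      (tendsto_natCast_atTop_atTop (R := ℝ))
    exact_mod_cast (continuous_coe_real_ereal.tendsto 0).comp this
  refine (h.congr' ?_).limsup_eq
  filter_upwards [eventually_gt_atTop 0] with n hn
  rw [← ENNReal.ofReal_natCast, ENNReal.log_ofReal_of_pos (by exact_mod_cast hn), EReal.coe_div,
    EReal.coe_natCast]

/-- If the numbers of elements of `Q` strictly and weakly below a point have the same sum for
`x < y`, then `Q` does not meet `[x, y]`. -/
theorem disjoint_Icc_of_card_add_card_eq {α : Type*} [LinearOrder α] {Q : Finset α} {x y : α}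
    (hxy : x < y)
    (h : (Q.filter (· < x)).card + (Q.filter (· ≤ x)).card =
      (Q.filter (· < y)).card + (Q.filter (· ≤ y)).card) :
    Disjoint (Icc x y) (Q : Set α) := by
  have h₁ : Q.filter (· < x) ⊆ Q.filter (· < y) :=
    Finset.monotone_filter_right _ fun q _ hq ↦ lt_trans hq hxy
  have h₂ : Q.filter (· ≤ x) ⊆ Q.filter (· ≤ y) :=
    Finset.monotone_filter_right _ fun q _ hq ↦ le_trans hq hxy.le
  have e₁ := Finset.eq_of_subset_of_card_le h₁ (by have := Finset.card_le_card h₂; omega)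
  have e₂ := Finset.eq_of_subset_of_card_le h₂ (by have := Finset.card_le_card h₁; omega)
  rw [Set.disjoint_left]
  intro q hq hqQ
  rcases hq.1.eq_or_lt with rfl | hlt
  · have : x ∈ Q.filter (· < y) := Finset.mem_filter.2 ⟨hqQ, hxy⟩
    rw [← e₁] at this
    exact (Finset.mem_filter.1 this).2.false
  · have : q ∈ Q.filter (· ≤ y) := Finset.mem_filter.2 ⟨hqQ, hq.2⟩
    rw [← e₂] at this
    exact hlt.not_ge (Finset.mem_filter.1 this).2

/-- If a map `c` to `Fin m` identifies only points that are `U`-close, then `m` points suffice to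
`U`-cover the whole space. -/
theorem SetRel.exists_isCover_univ_card_le {X : Type*} {U : SetRel X X} {m : ℕ} (c : X → Fin m)
    (hc : ∀ x y, c x = c y → (x, y) ∈ U) :
    ∃ s : Finset X, SetRel.IsCover U univ (s : Set X) ∧ s.card ≤ m := by
  classical
  have hr : ∀ i : range c, ∃ x, c x = i := fun i ↦ i.2
  choose g hg using hr
  refine ⟨Finset.univ.image g, fun x _ ↦ ⟨g ⟨c x, x, rfl⟩, by simp, hc _ _ (hg ⟨c x, x, rfl⟩).symm⟩,
    Finset.card_image_le.trans ?_⟩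
  rw [Finset.card_univ]
  exact (Fintype.card_subtype_le _).trans_eq (Fintype.card_fin m)

namespace AddCircle

/-- The points `i / N` of the circle `ℝ / ℤ`. -/
noncomputable def gridPoints (N : ℕ) : Finset (AddCircle (1 : ℝ)) :=
  (Finset.range N).image fun i : ℕ ↦ ((i / N : ℝ) : AddCircle (1 : ℝ))

theorem card_gridPoints_le (N : ℕ) : (gridPoints N).card ≤ N :=
  Finset.card_image_le.trans_eq (Finset.card_range N)

theorem coe_div_mem_gridPoints {N i : ℕ} (hi : i < N) :
    ((i / N : ℝ) : AddCircle (1 : ℝ)) ∈ gridPoints N :=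
  Finset.mem_image_of_mem _ (Finset.mem_range.2 hi)

/-- A preconnected subset of the circle that avoids the points `i / N` has diameter at most
`1 / N`. -/
theorem dist_le_of_isPreconnected_of_disjoint_gridPoints {N : ℕ} (hN : 0 < N)
    {S : Set (AddCircle (1 : ℝ))} (hS : IsPreconnected S)
    (hd : Disjoint S (gridPoints N : Set (AddCircle (1 : ℝ))))
    {x y : AddCircle (1 : ℝ)} (hx : x ∈ S) (hy : y ∈ S) : dist x y ≤ 1 / N := by
  have hN' : (0 : ℝ) < N := by exact_mod_cast hN
  let e : AddCircle (1 : ℝ) → ℝ := fun z ↦ equivIco 1 0 z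
  have he : ∀ z, ((e z : ℝ) : AddCircle (1 : ℝ)) = z := fun z ↦ coe_equivIco
  have he' : ∀ z, e z ∈ Ico (0 : ℝ) 1 := fun z ↦ by simpa using (equivIco (1 : ℝ) 0 z).2
  have hcont : ContinuousOn e S := fun z hz ↦ by
    have hz0 : z ≠ ((0 : ℝ) : AddCircle (1 : ℝ)) := by
      rintro rfl
      exact Set.disjoint_left.1 hd hz (by simpa using coe_div_mem_gridPoints hN)
    exact (continuousAt_subtype_val.comp (continuousAt_equivIco 1 0 hz0)).continuousWithinAt
  have hord : OrdConnected (e '' S) := (hS.image e hcont).ordConnected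
  wlog hxy : e x ≤ e y generalizing x y
  · rw [dist_comm]
    exact this hy hx (le_of_not_ge hxy)
  have hlt : e y - e x < 1 / N := by
    by_contra! hge
    have hmul : e x * N + 1 ≤ e y * N := by
      rw [div_le_iff₀ hN'] at hge
      linarith
    have h0 : 0 ≤ e x * N := mul_nonneg (he' x).1 hN'.le
    have hle : (⌈e x * N⌉₊ : ℝ) ≤ e y * N := (Nat.ceil_lt_add_one h0).le.trans hmul
    have hmem : (⌈e x * N⌉₊ / N : ℝ) ∈ Icc (e x) (e y) :=
      ⟨(le_div_iff₀ hN').2 (Nat.le_ceil _), (div_le_iff₀ hN').2 hle⟩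
    obtain ⟨z, hz, hze⟩ := hord.out (mem_image_of_mem e hx) (mem_image_of_mem e hy) hmem
    have hlN : ⌈e x * N⌉₊ < N := by
      have : e y * N < 1 * N := mul_lt_mul_of_pos_right (he' y).2 hN'
      exact_mod_cast hle.trans_lt (this.trans_eq (one_mul _))
    refine Set.disjoint_left.1 hd hz ?_
    rw [← he z, hze]
    exact coe_div_mem_gridPoints hlN
  calc dist x y = ‖((e x - e y : ℝ) : AddCircle (1 : ℝ))‖ := by
        rw [coe_sub, he, he, dist_eq_norm]
    _ ≤ ‖e x - e y‖ := QuotientAddGroup.norm_mk_le_norm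
    _ ≤ 1 / N := by
        rw [Real.norm_eq_abs, abs_sub_comm, abs_of_nonneg (sub_nonneg.2 hxy)]
        exact hlt.le

/-- For an injective continuous map of the circle, the number of points needed to cover the circle
up to time `n` and scale `1 / N` grows at most linearly in `n`. -/
theorem coverMincard_le {f : AddCircle (1 : ℝ) → AddCircle (1 : ℝ)} (hf : Continuous f)
    (hinj : Function.Injective f) {N : ℕ} (hN : 0 < N) (n : ℕ) :
    Dynamics.coverMincard f univ {p | dist p.1 p.2 ≤ 1 / N} n ≤ (2 * (n * N) + 1 : ℕ) := by
  classical
  let e : AddCircle (1 : ℝ) → ℝ := fun z ↦ equivIco 1 0 z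
  have he : ∀ z, ((e z : ℝ) : AddCircle (1 : ℝ)) = z := fun z ↦ coe_equivIco
  let Q : Finset ℝ := (Finset.range n).biUnion fun k ↦
    ((gridPoints N).preimage f^[k] (hinj.iterate k).injOn).image e
  have hQ : Q.card ≤ n * N := by
    refine (Finset.card_biUnion_le_card_mul _ _ N fun k _ ↦ ?_).trans_eq (by simp)
    refine Finset.card_image_le.trans (le_trans ?_ (card_gridPoints_le N))
    exact Finset.card_le_card_of_injOn f^[k] (fun z hz ↦ by simpa using hz)
      (hinj.iterate k).injOn
  have key : ∀ x y, e x < e y → Disjoint (Icc (e x) (e y)) (Q : Set ℝ) →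
      ∀ k < n, dist (f^[k] x) (f^[k] y) ≤ 1 / N := by
    intro x y hxy hd k hk
    have hS : IsPreconnected
        ((fun t : ℝ ↦ f^[k] (t : AddCircle (1 : ℝ))) '' Icc (e x) (e y)) :=
      isPreconnected_Icc.image _
        ((hf.iterate k).comp (AddCircle.continuous_mk' 1)).continuousOn
    refine dist_le_of_isPreconnected_of_disjoint_gridPoints hN hS ?_
      ⟨e x, left_mem_Icc.2 hxy.le, by simp only [he]⟩
      ⟨e y, right_mem_Icc.2 hxy.le, by simp only [he]⟩
    rw [Set.disjoint_left]
    rintro _ ⟨t, ht, rfl⟩ htN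
    have ht' : e (t : AddCircle (1 : ℝ)) = t := by
      have hx0 : 0 ≤ e x := (equivIco (1 : ℝ) 0 x).2.1
      have hy1 : e y < 0 + 1 := (equivIco (1 : ℝ) 0 y).2.2
      exact equivIco_coe_of_mem ⟨hx0.trans ht.1, ht.2.trans_lt hy1⟩
    refine Set.disjoint_left.1 hd ht ?_
    simp only [Q, Finset.coe_biUnion, mem_iUnion, Finset.coe_image, Finset.coe_preimage]
    exact ⟨k, by simpa using hk, t, htN, ht'⟩
  let c : AddCircle (1 : ℝ) → Fin (2 * (n * N) + 1) := fun x ↦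
    ⟨(Q.filter (· < e x)).card + (Q.filter (· ≤ e x)).card, by
      have h₁ := Finset.card_filter_le Q (· < e x)
      have h₂ := Finset.card_filter_le Q (· ≤ e x)
      omega⟩
  obtain ⟨s, hs, hcard⟩ := SetRel.exists_isCover_univ_card_le
    (U := Dynamics.dynEntourage f {p | dist p.1 p.2 ≤ 1 / N} n) c fun x y hxy ↦ by
      rw [Dynamics.mem_dynEntourage]
      intro k hk
      have hval := congrArg Fin.val hxy
      rcases lt_trichotomy (e x) (e y) with h | h | h
      · exact key x y h (disjoint_Icc_of_card_add_card_eq h hval) k hk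
      · have : x = y := by rw [← he x, h, he y]
        simp [this]
      · rw [mem_ofPred_eq, dist_comm]
        exact key y x h (disjoint_Icc_of_card_add_card_eq h hval.symm) k hk
  exact (Dynamics.IsDynCoverOf.coverMincard_le_card hs).trans (by exact_mod_cast hcard)

end AddCircle

/-- Every homeomorphism of the circle `𝕋 = ℝ/ℤ` has zero topological entropy. -/
theorem circle_homeomorphism_entropy_zero
    (f : AddCircle (1 : ℝ) ≃ₜ AddCircle (1 : ℝ)) :
    Dynamics.coverEntropy (⇑f) Set.univ = 0 := by
  refine le_antisymm (iSup₂_le fun U hU ↦ ?_) (Dynamics.coverEntropy_nonneg _ univ_nonempty)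
  obtain ⟨ε, hε, hεU⟩ := Metric.mem_uniformity_dist.1 hU
  obtain ⟨N, hN⟩ := exists_nat_one_div_lt hε
  have hsub : {p : AddCircle (1 : ℝ) × AddCircle (1 : ℝ) | dist p.1 p.2 ≤ 1 / (N + 1 : ℕ)} ⊆ U :=
    fun p hp ↦ hεU (lt_of_le_of_lt hp (by exact_mod_cast hN))
  refine (Dynamics.coverEntropyEntourage_antitone _ _ hsub).trans ?_
  rw [← ExpGrowth.expGrowthSup_natCast]
  refine ExpGrowth.expGrowthSup_le_of_eventually_le (b := (2 * (N + 1) + 1 : ℕ))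
    (ENNReal.natCast_ne_top _) ?_
  filter_upwards [eventually_ge_atTop 1] with n hn
  have hle := AddCircle.coverMincard_le f.continuous f.injective N.succ_pos n
  have hle' : 2 * (n * (N + 1)) + 1 ≤ (2 * (N + 1) + 1) * n := by nlinarith
  have := ENat.toENNReal_mono (hle.trans (Nat.cast_le.2 hle'))
  exact_mod_cast this
end
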